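/- arXiv:1212.5138 — 5 statements merged into one kernel-verified Lean document; each statement's English description precedes it below -/
import Mathlib

section
/- Let ω₁, ω₃ ∈ ℂ be ℝ-linearly independent, let Γ = {2mω₁ + 2nω₃ : m, n ∈ ℤ}, and let p ∈ ℂ∖Γ. Suppose s₁ and s₂ are holomorphic functions on ℂ∖(Γ ∪ (p + Γ)) such that for i = 1, 2: s_i(z + γ) = s_i(z) for all γ ∈ Γ, and at every point q ∈ Γ ∪ (p + Γ) the function s_i has at most a simple pole with vanishing constant Laurent term at q, i.e., there exists r ∈ ℂ with s_i(z) − r/(z − q) → 0 as z → q. Then s₁ and s₂ are linearly dependent over ℂ. -/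
open Complex Filter Set Topology

/-- The lattice `Γ = {2mω₁ + 2nω₃ : m, n ∈ ℤ}`. -/
def lat (ω₁ ω₃ : ℂ) : Set ℂ := {z | ∃ m n : ℤ, z = 2 * (m : ℂ) * ω₁ + 2 * (n : ℂ) * ω₃}

/-- The set of translates `Γ ∪ (p + Γ)` of the two ends. -/
def Pset (ω₁ ω₃ p : ℂ) : Set ℂ := lat ω₁ ω₃ ∪ (fun γ => p + γ) '' lat ω₁ ω₃

lemma aux_ev (L : PeriodPair) (x : ℂ) : ∀ᶠ z in 𝓝[≠] x, z ∉ L.lattice := by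
  have h := L.compl_lattice_sdiff_singleton_mem_nhds x
  rw [eventually_nhdsWithin_iff]
  filter_upwards [h] with z hz hzx hzL
  exact hz ⟨hzL, hzx⟩

lemma aux_shift (x g : ℂ) : Tendsto (fun z => z + g) (𝓝[≠] x) (𝓝[≠] (x + g)) := by
  apply tendsto_nhdsWithin_of_tendsto_nhds_of_eventually_within
  · exact (Continuous.tendsto (by fun_prop) x).mono_left nhdsWithin_le_nhds
  · filter_upwards [self_mem_nhdsWithin] with z hz
    simpa using hz

lemma aux_ev_shift (L : PeriodPair) (x g : ℂ) : ∀ᶠ z in 𝓝[≠] x, z + g ∉ L.lattice :=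
  (aux_shift x g).eventually (aux_ev L (x + g))

lemma aux_translate {f : ℂ → ℂ} {q g : ℂ} {l : Filter ℂ}
    (h : Tendsto f (𝓝[≠] q) l) (hper : ∀ᶠ z in 𝓝[≠] q, f (z + g) = f z) :
    Tendsto f (𝓝[≠] (q + g)) l := by
  have h1 : Tendsto (fun z => z + -g) (𝓝[≠] (q + g)) (𝓝[≠] q) := by
    simpa using aux_shift (q + g) (-g)
  refine (h.comp h1).congr' ?_
  filter_upwards [h1.eventually hper] with z hz
  simpa using hz.symm

/-- Liouville for periodic functions with removable singularities on the lattice. -/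
lemma aux_liouville (L : PeriodPair) (f : ℂ → ℂ) (c : ℂ)
    (hd : ∀ z ∉ L.lattice, DifferentiableAt ℂ f z)
    (hper : ∀ z ∉ L.lattice, ∀ g ∈ L.lattice, f (z + g) = f z)
    (hc : Tendsto f (𝓝[≠] 0) (𝓝 c)) :
    ∀ z ∉ L.lattice, f z = c := by
  classical
  set F : ℂ → ℂ := fun z => if z ∈ L.lattice then c else f z with hF
  have hFd : ∀ z ∉ L.lattice, DifferentiableAt ℂ F z := by
    intro z hz
    refine (hd z hz).congr_of_eventuallyEq ?_
    filter_upwards [L.isClosed_lattice.isOpen_compl.mem_nhds hz] with w hw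
    exact if_neg hw
  have hdiff : Differentiable ℂ F := by
    intro x
    by_cases hx : x ∈ L.lattice
    · refine (analyticAt_of_differentiable_on_punctured_nhds_of_continuousAt
        ((aux_ev L x).mono hFd) ?_).differentiableAt
      rw [continuousAt_iff_punctured_nhds]
      have h1 : F x = c := if_pos hx
      rw [h1]
      have h2 : Tendsto f (𝓝[≠] x) (𝓝 c) := by
        have := aux_translate (g := x) hc ((aux_ev L 0).mono fun z hz => hper z hz x hx)
        simpa using this
      refine h2.congr' ?_
      filter_upwards [aux_ev L x] with w hw
      exact (if_neg hw).symm
    · exact hFd x hx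
  have hFper : ∀ z w, w ∈ L.lattice → F (z + w) = F z := by
    intro z w hw
    by_cases hz : z ∈ L.lattice
    · simp [hF, hz, add_mem hz hw]
    · have : z + w ∉ L.lattice := fun h => hz (by simpa using sub_mem h hw)
      simp [hF, hz, this, hper z hz w hw]
  intro z hz
  have h := hdiff.apply_eq_apply_of_bounded (IsZLattice.isCompact_range_of_periodic L.lattice _
    hdiff.continuous hFper).isBounded z 0
  simpa [hF, hz] using h

/-- An elliptic function with a single simple pole per period cell, with zero constant term,
vanishes. -/
lemma aux_single (L : PeriodPair) (u : ℂ → ℂ) (r : ℂ)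
    (hd : ∀ z ∉ L.lattice, DifferentiableAt ℂ u z)
    (hper : ∀ z ∉ L.lattice, ∀ g ∈ L.lattice, u (z + g) = u z)
    (hr : Tendsto (fun z => u z - r / z) (𝓝[≠] 0) (𝓝 0)) :
    ∀ z ∉ L.lattice, u z = 0 := by
  by_cases hr0 : r = 0
  · subst hr0
    exact aux_liouville L u 0 hd hper (by simpa using hr)
  exfalso
  have hneg : Tendsto (fun z : ℂ => -z) (𝓝[≠] 0) (𝓝[≠] 0) := by
    apply tendsto_nhdsWithin_of_tendsto_nhds_of_eventually_within
    · have : Tendsto (fun z : ℂ => -z) (𝓝 0) (𝓝 (-0)) := Continuous.tendsto (by fun_prop) 0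
      rw [neg_zero] at this
      exact this.mono_left nhdsWithin_le_nhds
    · filter_upwards [self_mem_nhdsWithin] with z hz
      simpa using hz
  -- oddness
  have hodd : ∀ z ∉ L.lattice, u z + u (-z) = 0 := by
    refine aux_liouville L (fun z => u z + u (-z)) 0 ?_ ?_ ?_
    · intro z hz
      have h1 := hd z hz
      have h2 : DifferentiableAt ℂ u (-z) := hd (-z) (by simpa using hz)
      exact h1.add (h2.comp z differentiableAt_id.neg)
    · intro z hz g hg
      have h2 := hper (-z) (by simpa using hz) (-g) (neg_mem hg)
      simp only [hper z hz g hg]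
      rw [neg_add, h2]
    · have := hr.add (hr.comp hneg)
      rw [add_zero] at this
      refine this.congr fun z => ?_
      simp only [Function.comp, div_neg]
      ring
  have hhalf : ∀ w, w ∉ L.lattice → 2 * w ∈ L.lattice → u w = 0 := by
    intro w hw h2
    have h1 := hodd w hw
    have h3 := hper (-w) (by simpa using hw) (2 * w) h2
    have h4 : -w + 2 * w = w := by ring
    rw [h4] at h3
    rw [← h3] at h1
    simpa using h1
  set e := L.ω₁ / 2 with he
  have heL : e ∉ L.lattice := L.ω₁_div_two_notMem_lattice
  have h2e : 2 * e = L.ω₁ := by rw [he]; ring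
  have hue : u e = 0 := hhalf e heL (h2e ▸ L.ω₁_mem_lattice)
  have hindep : LinearIndependent ℝ ![L.ω₁ / 2, L.ω₂] := by
    rw [LinearIndependent.pair_iff]
    intro s t hst
    have := LinearIndependent.pair_iff.mp L.indep (s / 2) t (by
      simp only [real_smul] at hst ⊢
      push_cast
      linear_combination hst)
    exact ⟨by linarith [this.1], this.2⟩
  let L' : PeriodPair := ⟨L.ω₁ / 2, L.ω₂, hindep⟩
  have hsub : ∀ z ∈ L.lattice, z ∈ L'.lattice := by
    intro z hz
    obtain ⟨m, n, rfl⟩ := PeriodPair.mem_lattice.mp hz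
    refine PeriodPair.mem_lattice.mpr ⟨2 * m, n, ?_⟩
    simp only [L']
    push_cast
    ring
  have heL' : e ∈ L'.lattice := L'.ω₁_mem_lattice
  have hshift : ∀ z ∉ L'.lattice, z + e ∉ L'.lattice := by
    intro z hz h
    exact hz (by simpa using sub_mem h heL')
  have hvd : ∀ z, z + e ∉ L.lattice → DifferentiableAt ℂ (fun z => u (z + e)) z := by
    intro z hz
    exact (hd _ hz).comp z (differentiableAt_id.add_const e)
  set h : ℂ → ℂ := fun z => u z * u (z + e) with hh
  have h_e : ∀ z ∉ L'.lattice, h (z + e) = h z := by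
    intro z hz
    have h1 : u (z + e + e) = u z := by
      have := hper z (fun hz' => hz (hsub z hz')) L.ω₁ L.ω₁_mem_lattice
      rw [← this, ← h2e]; congr 1; ring
    simp only [hh, h1]; ring
  have h_L : ∀ z ∉ L'.lattice, ∀ g ∈ L.lattice, h (z + g) = h z := by
    intro z hz g hg
    have h1 := hper z (fun hz' => hz (hsub z hz')) g hg
    have h2 := hper (z + e) (fun hz' => hshift z hz (hsub _ hz')) g hg
    have h3 : z + g + e = z + e + g := by ring
    simp only [hh, h1, h3, h2]
  have h_per : ∀ z ∉ L'.lattice, ∀ g ∈ L'.lattice, h (z + g) = h z := by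
    intro z hz g hg
    obtain ⟨m, n, rfl⟩ := PeriodPair.mem_lattice.mp hg
    change h (z + (m * e + n * L.ω₂)) = h z
    obtain ⟨k, hk | hk⟩ := Int.even_or_odd' m
    · apply h_L z hz
      refine PeriodPair.mem_lattice.mpr ⟨k, n, ?_⟩
      rw [hk, ← h2e]; push_cast; ring
    · have h4 : z + (m * e + n * L.ω₂) = (z + e) + (k * L.ω₁ + n * L.ω₂) := by
        rw [hk, ← h2e]; push_cast; ring
      rw [h4, h_L _ (hshift z hz) _ (PeriodPair.mem_lattice.mpr ⟨k, n, rfl⟩), h_e z hz]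
  have hv0 : DifferentiableAt ℂ (fun z => u (z + e)) 0 := hvd 0 (by simpa using heL)
  have hzu : Tendsto (fun z => z * u z) (𝓝[≠] 0) (𝓝 r) := by
    have hid : Tendsto (fun z : ℂ => z) (𝓝[≠] 0) (𝓝 0) := nhdsWithin_le_nhds
    have := (hid.mul hr).add_const r
    simp only [zero_mul, zero_add] at this
    refine this.congr' ?_
    filter_upwards [self_mem_nhdsWithin] with z hz
    have hz : z ≠ 0 := hz
    field_simp
    ring
  obtain ⟨c, hc⟩ : ∃ c, Tendsto h (𝓝[≠] 0) (𝓝 c) := by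
    have h1 := hv0.hasDerivAt.tendsto_slope
    refine ⟨_, (hzu.mul h1).congr' ?_⟩
    filter_upwards [self_mem_nhdsWithin] with z hz
    have hz : z ≠ 0 := hz
    simp only [slope_def_field, zero_add, hue, sub_zero, hh]
    field_simp
  have hconst := aux_liouville L' h c (by
    intro z hz
    exact (hd z (fun hz' => hz (hsub z hz'))).mul
      (hvd z (fun hz' => hshift z hz (hsub _ hz')))) h_per hc
  have hf : L.ω₂ / 2 ∉ L'.lattice := L'.ω₂_div_two_notMem_lattice
  have huf : u (L.ω₂ / 2) = 0 := hhalf _ L.ω₂_div_two_notMem_lattice (by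
    have : 2 * (L.ω₂ / 2) = L.ω₂ := by ring
    rw [this]; exact L.ω₂_mem_lattice)
  have hc0 : c = 0 := by
    rw [← hconst _ hf]; simp [hh, huf]
  subst hc0
  have hune : ∀ᶠ z in 𝓝[≠] (0 : ℂ), u z ≠ 0 := by
    filter_upwards [hzu.eventually_ne hr0] with z hz h0
    simp [h0] at hz
  have hvz : ∀ᶠ z in 𝓝[≠] (0 : ℂ), u (z + e) = 0 := by
    filter_upwards [hune, aux_ev L' 0] with z hz hzL
    exact (mul_eq_zero.mp (hconst z hzL)).resolve_left hz
  have hue' : ∀ᶠ z in 𝓝[≠] e, u z = 0 := by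
    have h1 : Tendsto (fun z => z + -e) (𝓝[≠] e) (𝓝[≠] 0) := by
      simpa using aux_shift e (-e)
    filter_upwards [h1.eventually hvz] with z hz
    simpa using hz
  have hue2 : u =ᶠ[𝓝 e] 0 := by
    rw [eventually_nhdsWithin_iff] at hue'
    filter_upwards [hue'] with z hz
    by_cases hze : z = e
    · rw [hze]; exact hue
    · exact hz hze
  have hcount : (L.lattice : Set ℂ).Countable := by
    have : ((L.lattice : Set ℂ)) = Set.range (fun x : ℤ × ℤ => x.1 * L.ω₁ + x.2 * L.ω₂) := by
      ext z
      simp only [SetLike.mem_coe, PeriodPair.mem_lattice, Set.mem_range, Prod.exists]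
    rw [this]; exact Set.countable_range _
  have hconn : IsPreconnected ((L.lattice : Set ℂ)ᶜ) :=
    (hcount.isPathConnected_compl_of_one_lt_rank
      (by rw [Complex.rank_real_complex]; norm_num)).isConnected.isPreconnected
  have han : AnalyticOnNhd ℂ u ((L.lattice : Set ℂ)ᶜ) :=
    DifferentiableOn.analyticOnNhd (fun z hz => (hd z hz).differentiableWithinAt)
      L.isClosed_lattice.isOpen_compl
  have hz := han.eqOn_zero_of_preconnected_of_eventuallyEq_zero hconn heL hue2
  obtain ⟨z, hz1, hz2⟩ := (hune.and (aux_ev L 0)).exists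
  exact hz1 (hz hz2)

/-- Two `Γ`-periodic functions, holomorphic away from `Γ ∪ (p + Γ)` and with at most
simple poles with vanishing constant Laurent terms at the points of `Γ ∪ (p + Γ)`,
are linearly dependent over `ℂ`. -/
theorem two_ends_trivial_spin_dependent
    (ω₁ ω₃ p : ℂ) (hind : LinearIndependent ℝ ![ω₁, ω₃]) (hp : p ∉ lat ω₁ ω₃)
    (s₁ s₂ : ℂ → ℂ)
    (h₁hol : DifferentiableOn ℂ s₁ (Pset ω₁ ω₃ p)ᶜ)
    (h₂hol : DifferentiableOn ℂ s₂ (Pset ω₁ ω₃ p)ᶜ)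
    (h₁per : ∀ z ∉ Pset ω₁ ω₃ p, ∀ γ ∈ lat ω₁ ω₃, s₁ (z + γ) = s₁ z)
    (h₂per : ∀ z ∉ Pset ω₁ ω₃ p, ∀ γ ∈ lat ω₁ ω₃, s₂ (z + γ) = s₂ z)
    (h₁pole : ∀ q ∈ Pset ω₁ ω₃ p, ∃ r : ℂ,
      Tendsto (fun z => s₁ z - r / (z - q)) (𝓝[≠] q) (𝓝 0))
    (h₂pole : ∀ q ∈ Pset ω₁ ω₃ p, ∃ r : ℂ,
      Tendsto (fun z => s₂ z - r / (z - q)) (𝓝[≠] q) (𝓝 0)) :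
    ∃ a b : ℂ, (a ≠ 0 ∨ b ≠ 0) ∧ ∀ z ∉ Pset ω₁ ω₃ p, a * s₁ z + b * s₂ z = 0 := by
  classical
  have hind2 : LinearIndependent ℝ ![2 * ω₁, 2 * ω₃] := by
    rw [LinearIndependent.pair_iff] at hind ⊢
    intro s t hst
    refine hind s t ?_
    simp only [real_smul] at hst ⊢
    linear_combination hst / 2
  let L : PeriodPair := ⟨2 * ω₁, 2 * ω₃, hind2⟩
  have hL : ∀ z, z ∈ lat ω₁ ω₃ ↔ z ∈ L.lattice := by
    intro z
    rw [PeriodPair.mem_lattice]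
    constructor
    · rintro ⟨m, n, rfl⟩
      exact ⟨m, n, by simp only [L]; ring⟩
    · rintro ⟨m, n, rfl⟩
      exact ⟨m, n, by simp only [L]; ring⟩
  have hP : ∀ z, z ∈ Pset ω₁ ω₃ p ↔ z ∈ L.lattice ∨ z - p ∈ L.lattice := by
    intro z
    simp only [Pset, Set.mem_union, Set.mem_image, hL]
    refine or_congr Iff.rfl ⟨?_, fun h => ⟨z - p, h, by ring⟩⟩
    rintro ⟨g, hg, rfl⟩
    simpa using hg
  rw [hL] at hp
  have hPclosed : IsClosed (Pset ω₁ ω₃ p) := by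
    have : Pset ω₁ ω₃ p = (L.lattice : Set ℂ) ∪ (fun z => z - p) ⁻¹' (L.lattice : Set ℂ) := by
      ext z; exact hP z
    rw [this]
    exact L.isClosed_lattice.union (L.isClosed_lattice.preimage (by fun_prop))
  have h0P : (0 : ℂ) ∈ Pset ω₁ ω₃ p := (hP 0).2 (Or.inl (zero_mem _))
  have hpP : p ∈ Pset ω₁ ω₃ p := (hP p).2 (Or.inr (by simp))
  obtain ⟨r₁, hr₁⟩ := h₁pole 0 h0P
  obtain ⟨r₂, hr₂⟩ := h₂pole 0 h0P
  obtain ⟨q₁, hq₁⟩ := h₁pole p hpP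
  obtain ⟨q₂, hq₂⟩ := h₂pole p hpP
  obtain ⟨a, b, hab, hres⟩ : ∃ a b : ℂ, (a ≠ 0 ∨ b ≠ 0) ∧ a * r₁ + b * r₂ = 0 := by
    by_cases h : r₁ = 0
    · exact ⟨1, 0, by simp, by simp [h]⟩
    · exact ⟨r₂, -r₁, by simp [h], by ring⟩
  refine ⟨a, b, hab, ?_⟩
  set t : ℂ → ℂ := fun z => a * s₁ z + b * s₂ z with ht
  have htd : ∀ z ∉ Pset ω₁ ω₃ p, DifferentiableAt ℂ t z := by
    intro z hz
    have hn := hPclosed.isOpen_compl.mem_nhds hz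
    exact ((h₁hol.differentiableAt hn).const_mul a).add ((h₂hol.differentiableAt hn).const_mul b)
  have htper : ∀ z ∉ Pset ω₁ ω₃ p, ∀ g ∈ L.lattice, t (z + g) = t z := by
    intro z hz g hg
    simp only [ht, h₁per z hz g ((hL g).2 hg), h₂per z hz g ((hL g).2 hg)]
  have ht0 : Tendsto t (𝓝[≠] 0) (𝓝 0) := by
    have := (hr₁.const_mul a).add (hr₂.const_mul b)
    simp only [mul_zero, add_zero] at this
    refine this.congr fun z => ?_
    simp only [ht]
    linear_combination (-1 / (z - 0)) * hres
  have htp : Tendsto (fun z => t z - (a * q₁ + b * q₂) / (z - p)) (𝓝[≠] p) (𝓝 0) := by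
    have := (hq₁.const_mul a).add (hq₂.const_mul b)
    simp only [mul_zero, add_zero] at this
    refine this.congr fun z => ?_
    simp only [ht]
    ring
  have hevP : ∀ x, ∀ᶠ z in 𝓝[≠] x, z ∉ Pset ω₁ ω₃ p := by
    intro x
    filter_upwards [aux_ev L x, aux_ev_shift L x (-p)] with z h1 h2 h3
    rcases (hP z).1 h3 with h | h
    · exact h1 h
    · exact h2 (by simpa [sub_eq_add_neg] using h)
  have htL : ∀ g ∈ L.lattice, Tendsto t (𝓝[≠] g) (𝓝 0) := by
    intro g hg
    have := aux_translate (g := g) ht0 ((hevP 0).mono fun z hz => htper z hz g hg)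
    simpa using this
  have hnotP : ∀ z, z ∉ L.lattice → z + p ∉ L.lattice → z + p ∉ Pset ω₁ ω₃ p := by
    intro z h1 h2 h3
    rcases (hP _).1 h3 with h | h
    · exact h2 h
    · exact h1 (by simpa using h)
  set u : ℂ → ℂ := fun z => if z + p ∈ L.lattice then 0 else t (z + p) with hu
  have hud : ∀ z, z + p ∉ Pset ω₁ ω₃ p → DifferentiableAt ℂ u z := by
    intro z hz
    have h1 : DifferentiableAt ℂ (fun z => t (z + p)) z :=
      (htd _ hz).comp z (differentiableAt_id.add_const p)
    refine h1.congr_of_eventuallyEq ?_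
    have hc : Tendsto (fun w => w + p) (𝓝 z) (𝓝 (z + p)) := Continuous.tendsto (by fun_prop) z
    filter_upwards [hc.eventually (hPclosed.isOpen_compl.mem_nhds hz)] with w hw
    exact if_neg fun h => hw ((hP _).2 (Or.inl h))
  have huev : ∀ x, (fun z => t (z + p)) =ᶠ[𝓝[≠] x] u := by
    intro x
    filter_upwards [aux_ev_shift L x p] with w hw
    exact (if_neg hw).symm
  have key := aux_single L u (a * q₁ + b * q₂) (by
    intro z hz
    by_cases hzp : z + p ∈ L.lattice
    · refine (analyticAt_of_differentiable_on_punctured_nhds_of_continuousAt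
        (((aux_shift z p).eventually (hevP (z + p))).mono hud) ?_).differentiableAt
      rw [continuousAt_iff_punctured_nhds]
      have h1 : u z = 0 := if_pos hzp
      rw [h1]
      exact ((htL _ hzp).comp (aux_shift z p)).congr' (huev z)
    · exact hud z (hnotP z hz hzp)) (by
    intro z hz g hg
    have h1 : z + g + p = z + p + g := by ring
    by_cases hzp : z + p ∈ L.lattice
    · simp [hu, hzp, h1, add_mem hzp hg]
    · have h2 : z + p + g ∉ L.lattice := fun h => hzp (by simpa using sub_mem h hg)
      simp only [hu, hzp, h1, h2, if_false]
      exact htper _ (hnotP z hz hzp) g hg) (by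
    have h1 : Tendsto (fun z => z + p) (𝓝[≠] 0) (𝓝[≠] p) := by
      simpa using aux_shift 0 p
    refine (htp.comp h1).congr' ?_
    filter_upwards [huev 0] with z hz
    simp [← hz])
  intro z hz
  have h1 : z ∉ L.lattice := fun h => hz ((hP z).2 (Or.inl h))
  have h2 := key (z - p) (fun h => hz ((hP z).2 (Or.inr h)))
  simpa [hu, h1] using h2
end

section
/- Let ω₁, ω₃ ∈ ℂ be ℝ-linearly independent, let Γ = {2mω₁ + 2nω₃ : m, n ∈ ℤ}, and let p ∈ ℂ∖Γ. The set of holomorphic functions s on ℂ∖(Γ ∪ (p + Γ)) such that s(z + γ) = s(z) for all γ ∈ Γ and such that at every point q ∈ Γ ∪ (p + Γ) the function s has at most a simple pole at q (i.e., there exist r, c ∈ ℂ with s(z) − r/(z − q) → c as z → q) is a complex vector space of dimension 2. -/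
open Complex Filter Set Topology

/-- `s` is holomorphic away from `Γ ∪ (p + Γ)`, `Γ`-periodic, and has at most a simple
pole at every point of `Γ ∪ (p + Γ)`. -/
def CondSix (ω₁ ω₃ p : ℂ) (s : ℂ → ℂ) : Prop :=
  DifferentiableOn ℂ s (Pset ω₁ ω₃ p)ᶜ ∧
  (∀ z ∉ Pset ω₁ ω₃ p, ∀ γ ∈ lat ω₁ ω₃, s (z + γ) = s z) ∧
  ∀ q ∈ Pset ω₁ ω₃ p, ∃ r c : ℂ,
    Tendsto (fun z => s z - r / (z - q)) (𝓝[≠] q) (𝓝 c)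

lemma map_add_punct (a q : ℂ) : Filter.map (fun z => z + a) (𝓝[≠] q) = 𝓝[≠] (q + a) := by
  exact (Homeomorph.addRight a).map_punctured_nhds_eq q

lemma tendsto_add_punct (a q : ℂ) : Tendsto (fun z => z + a) (𝓝[≠] q) (𝓝[≠] (q + a)) :=
  (map_add_punct a q).le

lemma tendsto_neg_punct (q : ℂ) : Tendsto (fun z => -z) (𝓝[≠] q) (𝓝[≠] (-q)) :=
  ((Homeomorph.neg ℂ).map_punctured_nhds_eq q).le

/-- regularisation -/
noncomputable def reg (f : ℂ → ℂ) (z : ℂ) : ℂ := limUnder (𝓝[≠] z) f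

lemma reg_eq_of_tendsto {f : ℂ → ℂ} {q c : ℂ} (h : Tendsto f (𝓝[≠] q) (𝓝 c)) : reg f q = c :=
  h.limUnder_eq

lemma reg_eq_of_cont {f : ℂ → ℂ} {q : ℂ} (h : ContinuousAt f q) : reg f q = f q :=
  reg_eq_of_tendsto (h.tendsto.mono_left nhdsWithin_le_nhds)

lemma reg_diff {f : ℂ → ℂ} {q c : ℂ} (hd : ∀ᶠ w in 𝓝[≠] q, DifferentiableAt ℂ f w)
    (hc : Tendsto f (𝓝[≠] q) (𝓝 c)) : DifferentiableAt ℂ (reg f) q := by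
  have h1 : AnalyticAt ℂ (Function.update f q c) q := by
    apply Complex.analyticAt_of_differentiable_on_punctured_nhds_of_continuousAt
    · filter_upwards [hd, self_mem_nhdsWithin] with w hw hne
      refine hw.congr_of_eventuallyEq ?_
      filter_upwards [isOpen_ne.mem_nhds hne] with x hx
      exact Function.update_of_ne hx _ _
    · exact continuousAt_update_same.2 hc
  refine h1.differentiableAt.congr_of_eventuallyEq ?_
  filter_upwards [eventually_nhdsWithin_iff.1 hd] with w hw
  by_cases hwq : w = q
  · subst hwq
    rw [Function.update_self, reg_eq_of_tendsto hc]
  · rw [Function.update_of_ne hwq, reg_eq_of_cont (hw hwq).continuousAt]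

lemma reg_add {f : ℂ → ℂ} {q γ : ℂ} (h : ∀ᶠ w in 𝓝[≠] q, f (w + γ) = f w) :
    reg f (q + γ) = reg f q := by
  unfold reg limUnder
  rw [← map_add_punct, Filter.map_map]
  congr 1
  exact Filter.map_congr h

lemma tendsto_shift {f : ℂ → ℂ} {q γ : ℂ} {l : Filter ℂ} (h : ∀ᶠ w in 𝓝[≠] q, f (w + γ) = f w)
    (hq : Tendsto f (𝓝[≠] q) l) : Tendsto f (𝓝[≠] (q + γ)) l := by
  rw [← map_add_punct, tendsto_map'_iff]
  exact hq.congr' (h.mono fun w hw => hw.symm)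

/-- Liouville for elliptic functions. -/
lemma liouville_ell (L : PeriodPair) (f : ℂ → ℂ)
    (hd : ∀ q, ∀ᶠ w in 𝓝[≠] q, DifferentiableAt ℂ f w)
    (hper : ∀ γ ∈ L.lattice, ∀ q, ∀ᶠ w in 𝓝[≠] q, f (w + γ) = f w)
    (hlim : ∀ q, ∃ c, Tendsto f (𝓝[≠] q) (𝓝 c)) :
    ∃ c, (∀ q, Tendsto f (𝓝[≠] q) (𝓝 c)) ∧ ∀ q, ContinuousAt f q → f q = c := by
  have hdiff : Differentiable ℂ (reg f) := fun q => by
    obtain ⟨c, hc⟩ := hlim q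
    exact reg_diff (hd q) hc
  have hb := (IsZLattice.isCompact_range_of_periodic L.lattice _
    hdiff.continuous fun z w hw => reg_add (hper w hw z)).isBounded
  have key : ∀ q, reg f q = reg f 0 := fun q => hdiff.apply_eq_apply_of_bounded hb q 0
  refine ⟨reg f 0, fun q => ?_, fun q hq => ?_⟩
  · obtain ⟨c, hc⟩ := hlim q
    rw [← key q, reg_eq_of_tendsto hc]; exact hc
  · rw [← key q, reg_eq_of_cont hq]

lemma ev_notMem (L : PeriodPair) (q : ℂ) : ∀ᶠ w in 𝓝[≠] q, w ∉ L.lattice := by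
  filter_upwards [mem_nhdsWithin_of_mem_nhds (L.compl_lattice_sdiff_singleton_mem_nhds q),
    self_mem_nhdsWithin] with w hw hne hmem
  exact hw ⟨hmem, hne⟩

lemma ev_notMem_sub (L : PeriodPair) (p q : ℂ) : ∀ᶠ w in 𝓝[≠] q, w - p ∉ L.lattice := by
  have := (tendsto_add_punct (-p) q).eventually (ev_notMem L (q + -p))
  simpa [sub_eq_add_neg] using this

lemma no_simple (L : PeriodPair) (g : ℂ → ℂ) (hd : ∀ z ∉ L.lattice, DifferentiableAt ℂ g z)
    (hper : ∀ z ∉ L.lattice, ∀ γ ∈ L.lattice, g (z + γ) = g z) (r c : ℂ)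
    (h0 : Tendsto (fun z => g z - r / z) (𝓝[≠] 0) (𝓝 c)) : r = 0 := by
  wlog hc : c = 0 generalizing g c
  · refine this (fun z => g z - c) (fun z hz => (hd z hz).sub_const c)
      (fun z hz γ hγ => by rw [hper z hz γ hγ]) 0 ?_ rfl
    have := h0.sub_const c
    simp only [sub_self] at this
    exact this.congr fun z => by ring
  subst hc
  by_contra hr
  -- oddness
  have hodd : ∀ z ∉ L.lattice, g (-z) = - g z := by
    have hnd : ∀ z ∉ L.lattice, DifferentiableAt ℂ (fun z => g z + g (-z)) z := fun z hz =>
      (hd z hz).add ((hd (-z) (by simpa using hz)).comp z differentiableAt_id.neg)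
    have hp : ∀ γ ∈ L.lattice, ∀ q, ∀ᶠ w in 𝓝[≠] q,
        (fun z => g z + g (-z)) (w + γ) = (fun z => g z + g (-z)) w := by
      intro γ hγ q
      filter_upwards [ev_notMem L q] with w hw
      have h2 := hper (-w) (by simpa using hw) (-γ) (neg_mem hγ)
      simp only [hper w hw γ hγ, neg_add, h2]
    have hl0 : Tendsto (fun z => g z + g (-z)) (𝓝[≠] 0) (𝓝 0) := by
      have h1 := h0.comp (by simpa using tendsto_neg_punct 0 : Tendsto (fun z : ℂ => -z) (𝓝[≠] 0) (𝓝[≠] 0))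
      have h2 := h0.add h1
      simp only [add_zero] at h2
      refine h2.congr fun z => ?_
      simp only [Function.comp, div_neg]; ring
    obtain ⟨c, hc1, hc2⟩ := liouville_ell L (fun z => g z + g (-z))
      (fun q => (ev_notMem L q).mono hnd) hp (fun q => by
        by_cases hq : q ∈ L.lattice
        · refine ⟨0, ?_⟩
          have := tendsto_shift (hp q hq 0) hl0
          simpa using this
        · exact ⟨_, (hnd q hq).continuousAt.tendsto.mono_left nhdsWithin_le_nhds⟩)
    have hc : c = 0 := tendsto_nhds_unique (hc1 0) hl0
    intro z hz
    have := hc2 z (hnd z hz).continuousAt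
    rw [hc] at this
    exact eq_neg_of_add_eq_zero_right this
  have hhalf : ∀ w, w ∉ L.lattice → 2 * w ∈ L.lattice → g w = 0 := by
    intro w hw h2
    have h3 := hper (-w) (by simpa using hw) _ h2
    have h4 := hodd w hw
    have h5 : -w + 2 * w = w := by ring
    rw [h5, h4] at h3
    exact self_eq_neg.1 h3
  set u := L.ω₁ / 2 with hu
  set v := L.ω₂ / 2 with hv
  have hun : u ∉ L.lattice := L.ω₁_div_two_notMem_lattice
  have hvn : v ∉ L.lattice := L.ω₂_div_two_notMem_lattice
  have hu2 : 2 * u ∈ L.lattice := by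
    rw [hu, mul_div_cancel₀ _ (two_ne_zero)]; exact L.ω₁_mem_lattice
  have hv2 : 2 * v ∈ L.lattice := by
    rw [hv, mul_div_cancel₀ _ (two_ne_zero)]; exact L.ω₂_mem_lattice
  have huv : v - u ∉ L.lattice := by
    have := (L.mul_ω₁_add_mul_ω₂_mem_lattice (α := -1 / 2) (β := 1 / 2)).not.mpr (by norm_num)
    convert this using 2
    push_cast; rw [hu, hv]; ring
  set k : ℂ → ℂ := fun z => g z * g (z - u) with hk
  have hkd : ∀ z, z ∉ L.lattice → z - u ∉ L.lattice → DifferentiableAt ℂ k z := fun z h1 h2 =>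
    (hd z h1).mul ((hd (z - u) h2).comp z (differentiableAt_id.sub_const u))
  have hkp : ∀ γ ∈ L.lattice, ∀ q, ∀ᶠ w in 𝓝[≠] q, k (w + γ) = k w := by
    intro γ hγ q
    filter_upwards [ev_notMem L q, ev_notMem_sub L u q] with w hw hw2
    have h2 := hper (w - u) hw2 γ hγ
    have h3 : w + γ - u = w - u + γ := by ring
    simp only [hk, hper w hw γ hγ, h3, h2]
  have hku : ∀ q, ∀ᶠ w in 𝓝[≠] q, k (w + u) = k w := by
    intro q
    filter_upwards [ev_notMem L q, ev_notMem_sub L u q] with w hw hw2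
    have h2 := hper (w - u) hw2 _ hu2
    have h3 : w - u + 2 * u = w + u := by ring
    rw [h3] at h2
    simp only [hk, h2, add_sub_cancel_right, mul_comm]
  have hg0 : Tendsto (fun z => z * g z) (𝓝[≠] 0) (𝓝 r) := by
    have hid : Tendsto (fun z : ℂ => z) (𝓝[≠] 0) (𝓝 0) := nhdsWithin_le_nhds
    have h1 := (hid.mul h0).add_const r
    simp only [mul_zero, zero_add] at h1
    refine h1.congr' ?_
    filter_upwards [self_mem_nhdsWithin] with z hz
    have hz' : z ≠ 0 := hz
    field_simp
    ring
  have hnun : -u ∉ L.lattice := by simpa using hun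
  have hk0 : ∃ c, Tendsto k (𝓝[≠] 0) (𝓝 c) := by
    have h1 : HasDerivAt (fun z => g (z - u)) (deriv g (-u)) 0 := by
      have := (hd (-u) hnun).hasDerivAt
      exact HasDerivAt.comp_sub_const 0 u (by simpa using this)
    have h2 := hasDerivAt_iff_tendsto_slope_zero.1 h1
    have hgu : g (-u) = 0 := by rw [hodd u hun, hhalf u hun hu2, neg_zero]
    refine ⟨_, (hg0.mul h2).congr' ?_⟩
    filter_upwards [self_mem_nhdsWithin] with z hz
    have hz' : z ≠ 0 := hz
    simp only [zero_add, zero_sub, hgu, sub_zero, smul_eq_mul, hk]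
    field_simp
  obtain ⟨c0, hc0⟩ := hk0
  have hku0 : Tendsto k (𝓝[≠] u) (𝓝 c0) := by
    have := tendsto_shift (hku 0) hc0
    simpa using this
  obtain ⟨c, -, hc2⟩ := liouville_ell L k
    (fun q => by
      filter_upwards [ev_notMem L q, ev_notMem_sub L u q] with w hw hw2 using hkd w hw hw2)
    hkp (fun q => by
      by_cases hq : q ∈ L.lattice
      · have := tendsto_shift (hkp q hq 0) hc0
        exact ⟨c0, by simpa using this⟩
      by_cases hq2 : q - u ∈ L.lattice
      · have := tendsto_shift (hkp _ hq2 u) hku0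
        exact ⟨c0, by simpa using this⟩
      · exact ⟨_, (hkd q hq hq2).continuousAt.tendsto.mono_left nhdsWithin_le_nhds⟩)
  have hcz : c = 0 := by
    rw [← hc2 v (hkd v hvn huv).continuousAt]
    simp only [hk, hhalf v hvn hv2, zero_mul]
  -- g is nonzero near 0
  have hgne : ∀ᶠ z in 𝓝[≠] (0 : ℂ), g z ≠ 0 := by
    filter_upwards [hg0.eventually_ne hr] with z hz h
    exact hz (by rw [h, mul_zero])
  have hgz : ∀ᶠ z in 𝓝[≠] (0 : ℂ), g (z - u) = 0 := by
    filter_upwards [hgne, ev_notMem L 0, ev_notMem_sub L u 0] with z h1 h2 h3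
    have := hc2 z (hkd z h2 h3).continuousAt
    rw [hcz] at this
    exact (mul_eq_zero.1 this).resolve_left h1
  have hgz' : ∀ᶠ z in 𝓝[≠] (-u), g z = 0 := by
    have := map_add_punct (-u) 0
    rw [zero_add] at this
    rw [← this, Filter.eventually_map]
    simpa [sub_eq_add_neg] using hgz
  have hopen : IsOpen ((L.lattice : Set ℂ)ᶜ) := L.isClosed_lattice.isOpen_compl
  have han : AnalyticOnNhd ℂ g ((L.lattice : Set ℂ)ᶜ) :=
    DifferentiableOn.analyticOnNhd (fun z hz => (hd z hz).differentiableWithinAt) hopen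
  have hcount : (L.lattice : Set ℂ).Countable := by
    have : Countable L.lattice := L.latticeEquivProd.toEquiv.countable_iff.2 inferInstance
    exact this
  have hconn := (hcount.isConnected_compl_of_one_lt_rank (by simp)).isPreconnected
  have hzero := han.eqOn_zero_of_preconnected_of_frequently_eq_zero hconn hnun hgz'.frequently
  obtain ⟨z, h1, h2⟩ := (hgne.and (ev_notMem L 0)).exists
  exact h1 (hzero h2)

lemma dinv (a q : ℂ) (h : q - a ≠ 0) : DifferentiableAt ℂ (fun z : ℂ => 1 / (z - a)) q :=
  DifferentiableAt.fun_div (differentiableAt_const (1 : ℂ)) (differentiableAt_fun_id.sub_const a) h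

lemma dinv2 (b a q : ℂ) (h : q - b - a ≠ 0) :
    DifferentiableAt ℂ (fun z : ℂ => 1 / (z - b - a)) q :=
  DifferentiableAt.fun_div (differentiableAt_const (1 : ℂ))
    ((differentiableAt_fun_id.sub_const b).sub_const a) h

noncomputable def TT (p l z : ℂ) : ℂ := 1 / (z - l) - 1 / (z - p - l) + p / l ^ 2

lemma TT_bound (p l z : ℂ) (R : ℝ) (hR : 0 < R) (hz : ‖z‖ ≤ R) (hp : ‖p‖ ≤ R)
    (hl : 4 * R ≤ ‖l‖) : ‖TT p l z‖ ≤ 16 * R ^ 2 * ‖l‖ ^ (-3 : ℝ) := by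
  have hl0 : 0 < ‖l‖ := by linarith
  have h1 : ‖l‖ / 2 ≤ ‖z - l‖ := by
    rw [norm_sub_rev]
    exact .trans (by linarith) (norm_sub_norm_le l z)
  have hzp : ‖z - p‖ ≤ 2 * R := (norm_sub_le _ _).trans (by linarith)
  have h2 : ‖l‖ / 2 ≤ ‖z - p - l‖ := by
    rw [norm_sub_rev]
    exact .trans (by linarith) (norm_sub_norm_le l (z - p))
  have n0 : l ≠ 0 := norm_pos_iff.1 hl0
  have n1 : z - l ≠ 0 := norm_pos_iff.1 (by linarith)
  have n2 : z - p - l ≠ 0 := norm_pos_iff.1 (by linarith)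
  have e : TT p l z = p * (z * (z - p) - l * (z + (z - p))) / (l ^ 2 * (z - l) * (z - p - l)) := by
    unfold TT
    field_simp
    ring
  have e3 : ‖l‖ ^ (-3 : ℝ) = 1 / ‖l‖ ^ 3 := by
    rw [Real.rpow_neg hl0.le, one_div]; norm_cast
  have hnum : ‖z * (z - p) - l * (z + (z - p))‖ ≤ 4 * R * ‖l‖ := by
    calc _ ≤ ‖z‖ * ‖z - p‖ + ‖l‖ * (‖z‖ + ‖z - p‖) := by
          refine (norm_sub_le _ _).trans ?_
          rw [norm_mul, norm_mul]
          gcongr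
          exact norm_add_le _ _
      _ ≤ R * (2 * R) + ‖l‖ * (R + 2 * R) := by gcongr
      _ ≤ _ := by nlinarith
  rw [e, e3, norm_div, norm_mul, norm_mul, norm_mul, norm_pow]
  calc _ ≤ R * (4 * R * ‖l‖) / (‖l‖ ^ 2 * (‖l‖ / 2) * (‖l‖ / 2)) := by gcongr
    _ = _ := by field_simp; ring

noncomputable def FF (L : PeriodPair) (p z : ℂ) : ℂ := ∑' l : L.lattice, TT p l z

noncomputable def FE (L : PeriodPair) (p : ℂ) (l₀ : L.lattice) (z : ℂ) : ℂ :=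
  ∑' l : L.lattice, if l = l₀ then 0 else TT p l z

lemma FF_sum (L : PeriodPair) (p : ℂ) :
    HasSumLocallyUniformly (fun (l : L.lattice) (z : ℂ) => TT p l z) (FF L p) := by
  refine L.hasSumLocallyUniformly_aux (u := fun r l => 16 * (r + ‖p‖) ^ 2 * ‖l‖ ^ (-3 : ℝ)) _
    (fun _ _ => (ZLattice.summable_norm_rpow _ _ (by simp; norm_num)).mul_left _) fun r hr =>
    Filter.eventually_atTop.mpr ⟨4 * (r + ‖p‖), ?_⟩
  rintro _ h s hs l rfl
  have := norm_nonneg p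
  exact TT_bound p l s _ (by linarith) (by linarith) (by linarith) h

lemma FE_sum (L : PeriodPair) (p : ℂ) (l₀ : L.lattice) :
    HasSumLocallyUniformly (fun (l : L.lattice) (z : ℂ) => if l = l₀ then 0 else TT p l z)
      (FE L p l₀) := by
  refine L.hasSumLocallyUniformly_aux (u := fun r l => 16 * (r + ‖p‖) ^ 2 * ‖l‖ ^ (-3 : ℝ)) _
    (fun _ _ => (ZLattice.summable_norm_rpow _ _ (by simp; norm_num)).mul_left _) fun r hr =>
    Filter.eventually_atTop.mpr ⟨4 * (r + ‖p‖), ?_⟩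
  rintro _ h s hs l rfl
  have := norm_nonneg p
  split_ifs
  · rw [norm_zero]; positivity
  · exact TT_bound p l s _ (by linarith) (by linarith) (by linarith) h

lemma FF_eq (L : PeriodPair) (p : ℂ) (l₀ : L.lattice) (z : ℂ) :
    FF L p z = TT p l₀ z + FE L p l₀ z :=
  ((FF_sum L p).hasSum (x := z)).summable.tsum_eq_add_tsum_ite l₀

lemma FE_diff (L : PeriodPair) (p : ℂ) (l₀ : L.lattice) (q : ℂ)
    (h1 : q ∈ L.lattice → q = l₀) (h2 : q - p ∈ L.lattice → q - p = l₀) :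
    DifferentiableAt ℂ (FE L p l₀) q := by
  set U : Set ℂ := ((L.lattice : Set ℂ) \ {(l₀ : ℂ)})ᶜ ∩
    (fun z => z - p) ⁻¹' ((L.lattice : Set ℂ) \ {(l₀ : ℂ)})ᶜ with hU
  have hUo : IsOpen U := L.isOpen_compl_lattice_sdiff.inter
    (L.isOpen_compl_lattice_sdiff.preimage (by fun_prop))
  have hq : q ∈ U := ⟨fun h => h.2 (h1 h.1), fun h => h.2 (h2 h.1)⟩
  have hD : DifferentiableOn ℂ (FE L p l₀) U := by
    refine (FE_sum L p l₀).hasSumLocallyUniformlyOn.differentiableOn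
      (.of_forall fun s => .fun_sum fun i hi => ?_) hUo
    split_ifs with hi0
    · simp
    · intro z hz
      have hi' : (i : ℂ) ≠ l₀ := fun h => hi0 (Subtype.ext h)
      have n1 : z - i ≠ 0 := fun h => hz.1 (by
        rw [sub_eq_zero] at h; rw [h]; exact ⟨i.2, hi'⟩)
      have n2 : z - p - i ≠ 0 := fun h => hz.2 (by
        rw [sub_eq_zero] at h; beta_reduce; rw [h]; exact ⟨i.2, hi'⟩)
      exact (((dinv (i : ℂ) z n1).fun_sub (dinv2 p i z n2)).add_const _).differentiableWithinAt
  exact hD.differentiableAt (hUo.mem_nhds hq)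

lemma FF_diff (L : PeriodPair) (p q : ℂ) (h1 : q ∉ L.lattice) (h2 : q - p ∉ L.lattice) :
    DifferentiableAt ℂ (FF L p) q := by
  have e : FF L p = fun z => TT p (0 : L.lattice) z + FE L p 0 z := funext (FF_eq L p 0)
  rw [e]
  refine DifferentiableAt.add ?_ (FE_diff L p 0 q (fun h => absurd h h1) (fun h => absurd h h2))
  have n1 : q - 0 ≠ 0 := fun h => h1 (by rw [sub_eq_zero] at h; rw [h]; exact zero_mem _)
  have n2 : q - p - 0 ≠ 0 := fun h => h2 (by rw [sub_eq_zero] at h; rw [h]; exact zero_mem _)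
  exact ((dinv 0 q n1).fun_sub (dinv2 p 0 q n2)).add_const _

lemma hasSum_shift (L : PeriodPair) (γ : L.lattice) (f : L.lattice → ℂ) (a : ℂ)
    (h : HasSum f a) : HasSum (fun l => f (l + γ)) a :=
  (Equiv.hasSum_iff (Equiv.addRight γ)).2 h

lemma TT_shift (p z l γ : ℂ) :
    p * (1 / (-γ - l) ^ 2 - 1 / l ^ 2) = TT p (l + γ) (z + γ) - TT p l z := by
  unfold TT
  have a1 : z + γ - (l + γ : ℂ) = z - l := by ring
  have a2 : z + γ - p - (l + γ : ℂ) = z - p - l := by ring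
  have a3 : (-γ - l : ℂ) ^ 2 = (l + γ) ^ 2 := by ring
  rw [a1, a2, a3]
  ring

lemma FF_per (L : PeriodPair) (p z : ℂ) (γ : L.lattice) : FF L p (z + γ) = FF L p z := by
  have k1 : HasSum (fun l : L.lattice => TT p (l : ℂ) (z + γ)) (FF L p (z + γ)) :=
    (FF_sum L p).hasSum
  have k2 := hasSum_shift L γ _ _ k1
  have k3 : HasSum (fun l : L.lattice => TT p (l : ℂ) z) (FF L p z) := (FF_sum L p).hasSum
  have e2 := (L.hasSum_weierstrassP ((-γ : L.lattice) : ℂ)).mul_left p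
  rw [L.weierstrassP_coe, mul_zero] at e2
  have k4 := k2.sub k3
  have e3 : (fun l : L.lattice => p * (1 / (((-γ : L.lattice) : ℂ) - l) ^ 2 - 1 / (l : ℂ) ^ 2)) =
      fun l : L.lattice => TT p ((l + γ : L.lattice) : ℂ) (z + γ) - TT p (l : ℂ) z := by
    funext l
    rw [Submodule.coe_neg, Submodule.coe_add]
    exact TT_shift p z l γ
  rw [e3] at e2
  exact sub_eq_zero.1 (k4.unique e2)

lemma FF_pole1 (L : PeriodPair) (p : ℂ) (hp : p ∉ L.lattice) (q : ℂ) (hq : q ∈ L.lattice) :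
    ∃ c, Tendsto (fun z => FF L p z - 1 / (z - q)) (𝓝[≠] q) (𝓝 c) := by
  have hqp : q - p ∉ L.lattice := fun h => hp (by simpa using sub_mem hq h)
  have h1 := FE_diff L p ⟨q, hq⟩ q (fun _ => rfl) (fun h => absurd h hqp)
  have n2 : q - p - q ≠ 0 := fun h => hp (by
    have : p = 0 := by linear_combination -h
    rw [this]; exact zero_mem _)
  have h2 : DifferentiableAt ℂ (fun z => -(1 / (z - p - q)) + p / q ^ 2 + FE L p ⟨q, hq⟩ z) q :=
    ((dinv2 p q q n2).fun_neg.add_const _).fun_add h1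
  refine ⟨_, (h2.continuousAt.tendsto.mono_left nhdsWithin_le_nhds).congr fun z => ?_⟩
  rw [FF_eq L p ⟨q, hq⟩ z, TT]
  ring

lemma FF_pole2 (L : PeriodPair) (p : ℂ) (hp : p ∉ L.lattice) (q : ℂ) (hq : q - p ∈ L.lattice) :
    ∃ c, Tendsto (fun z => FF L p z - (-1) / (z - q)) (𝓝[≠] q) (𝓝 c) := by
  have hqp : q ∉ L.lattice := fun h => hp (by simpa using sub_mem h hq)
  have h1 := FE_diff L p ⟨q - p, hq⟩ q (fun h => absurd h hqp) (fun _ => rfl)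
  have n2 : q - (q - p) ≠ 0 := fun h => hp (by
    have : p = 0 := by linear_combination h
    rw [this]; exact zero_mem _)
  have h2 : DifferentiableAt ℂ
      (fun z => 1 / (z - (q - p)) + p / (q - p) ^ 2 + FE L p ⟨q - p, hq⟩ z) q :=
    ((dinv (q - p) q n2).add_const _).fun_add h1
  refine ⟨_, (h2.continuousAt.tendsto.mono_left nhdsWithin_le_nhds).congr fun z => ?_⟩
  rw [FF_eq L p ⟨q - p, hq⟩ z, TT]
  have e : z - p - (q - p) = z - q := by ring
  simp only [e]
  ring

lemma two_ends_aux (L : PeriodPair) (p : ℂ) (hp : p ∉ L.lattice) (s : ℂ → ℂ)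
    (hd : ∀ z, z ∉ L.lattice → z - p ∉ L.lattice → DifferentiableAt ℂ s z)
    (hper : ∀ z, z ∉ L.lattice → z - p ∉ L.lattice → ∀ γ ∈ L.lattice, s (z + γ) = s z)
    (h0 : ∃ r c : ℂ, Tendsto (fun z => s z - r / z) (𝓝[≠] 0) (𝓝 c))
    (hpp : ∃ r c : ℂ, Tendsto (fun z => s z - r / (z - p)) (𝓝[≠] p) (𝓝 c)) :
    ∃ a b, ∀ z, z ∉ L.lattice → z - p ∉ L.lattice → s z = a * FF L p z + b := by
  obtain ⟨r, c, h0⟩ := h0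
  obtain ⟨r', c', hpp⟩ := hpp
  set t : ℂ → ℂ := fun z => s z - r * FF L p z with ht
  have htd : ∀ z, z ∉ L.lattice → z - p ∉ L.lattice → DifferentiableAt ℂ t z := fun z h1 h2 =>
    (hd z h1 h2).sub ((FF_diff L p z h1 h2).const_mul r)
  have htp : ∀ γ ∈ L.lattice, ∀ q, ∀ᶠ w in 𝓝[≠] q, t (w + γ) = t w := by
    intro γ hγ q
    filter_upwards [ev_notMem L q, ev_notMem_sub L p q] with w hw hw2
    simp only [ht, hper w hw hw2 γ hγ, FF_per L p w ⟨γ, hγ⟩]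
  have htde : ∀ q, ∀ᶠ w in 𝓝[≠] q, DifferentiableAt ℂ t w := fun q => by
    filter_upwards [ev_notMem L q, ev_notMem_sub L p q] with w hw hw2 using htd w hw hw2
  obtain ⟨c1, hc1⟩ := FF_pole1 L p hp 0 (zero_mem _)
  obtain ⟨c2, hc2⟩ := FF_pole2 L p hp p (by simp)
  have ht0 : Tendsto t (𝓝[≠] 0) (𝓝 (c - r * c1)) := by
    refine (h0.sub (hc1.const_mul r)).congr fun z => ?_
    simp only [ht, sub_zero]; ring
  have htl : ∀ q ∈ L.lattice, Tendsto t (𝓝[≠] q) (𝓝 (c - r * c1)) := fun q hq => by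
    simpa using tendsto_shift (htp q hq 0) ht0
  have htpp : Tendsto (fun z => t z - (r' + r) / (z - p)) (𝓝[≠] p) (𝓝 (c' - r * c2)) := by
    refine (hpp.sub (hc2.const_mul r)).congr fun z => ?_
    simp only [ht]; ring
  have hregd : ∀ z, z - p ∉ L.lattice → DifferentiableAt ℂ (reg t) z := fun z hz => by
    by_cases hzl : z ∈ L.lattice
    · exact reg_diff (htde z) (htl z hzl)
    · exact reg_diff (htde z)
        ((htd z hzl hz).continuousAt.tendsto.mono_left nhdsWithin_le_nhds)
  have hres : r' + r = 0 := by
    refine no_simple L (fun z => reg t (z + p)) (fun z hz => ?_) (fun z hz γ hγ => ?_) (r' + r)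
      (c' - r * c2) ?_
    · exact DifferentiableAt.fun_comp' (g := reg t) (f := fun z => z + p) z
        (hregd (z + p) (by simpa using hz)) (differentiableAt_fun_id.add_const p)
    · have : z + γ + p = z + p + γ := by ring
      simp only [this]
      exact reg_add (htp γ hγ _)
    · have h1 : Tendsto (fun z : ℂ => z + p) (𝓝[≠] 0) (𝓝[≠] p) := by
        simpa using tendsto_add_punct p 0
      refine (htpp.comp h1).congr' ?_
      filter_upwards [h1.eventually (htde p)] with z hz
      simp only [Function.comp, add_sub_cancel_right, reg_eq_of_cont hz.continuousAt]
  rw [hres] at htpp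
  simp only [zero_div, sub_zero] at htpp
  obtain ⟨b, -, hb⟩ := liouville_ell L t htde htp fun q => by
    by_cases hq : q ∈ L.lattice
    · exact ⟨_, htl q hq⟩
    by_cases hq2 : q - p ∈ L.lattice
    · have := tendsto_shift (htp _ hq2 p) htpp
      exact ⟨_, by simpa using this⟩
    · exact ⟨_, (htd q hq hq2).continuousAt.tendsto.mono_left nhdsWithin_le_nhds⟩
  refine ⟨r, b, fun z h1 h2 => ?_⟩
  rw [← hb z (htd z h1 h2).continuousAt]
  simp only [ht]; ring

/-- The space of `Γ`-periodic functions with at most simple poles at the points of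
`Γ ∪ (p + Γ)` has complex dimension 2: there are two such functions, linearly
independent on the common domain, spanning all such functions on the common domain. -/
theorem two_ends_periodic_simple_pole_space_dim_two
    (ω₁ ω₃ p : ℂ) (hind : LinearIndependent ℝ ![ω₁, ω₃]) (hp : p ∉ lat ω₁ ω₃) :
    ∃ b : Fin 2 → ℂ → ℂ,
      (∀ i, CondSix ω₁ ω₃ p (b i)) ∧
      (∀ c : Fin 2 → ℂ, (∀ z ∉ Pset ω₁ ω₃ p, ∑ i, c i * b i z = 0) → c = 0) ∧
      (∀ s : ℂ → ℂ, CondSix ω₁ ω₃ p s →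
        ∃ c : Fin 2 → ℂ, ∀ z ∉ Pset ω₁ ω₃ p, s z = ∑ i, c i * b i z) := by
  have hind' : LinearIndependent ℝ ![2 * ω₁, 2 * ω₃] := by
    rw [LinearIndependent.pair_iff] at hind ⊢
    intro a b hab
    refine hind a b ?_
    have h2 : (2 : ℂ) * (a • ω₁ + b • ω₃) = 0 := by
      rw [← hab]; simp only [Complex.real_smul]; ring
    exact (mul_eq_zero.1 h2).resolve_left two_ne_zero
  set L : PeriodPair := ⟨2 * ω₁, 2 * ω₃, hind'⟩ with hL
  have hlat : ∀ z, z ∈ lat ω₁ ω₃ ↔ z ∈ L.lattice := by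
    intro z
    rw [PeriodPair.mem_lattice]
    constructor
    · rintro ⟨m, n, h⟩
      exact ⟨m, n, by rw [h]; simp only [hL]; ring⟩
    · rintro ⟨m, n, h⟩
      exact ⟨m, n, by rw [← h]; simp only [hL]; ring⟩
  have hP : ∀ z, z ∈ Pset ω₁ ω₃ p ↔ (z ∈ L.lattice ∨ z - p ∈ L.lattice) := by
    intro z
    unfold Pset
    rw [Set.mem_union, hlat]
    refine or_congr Iff.rfl ⟨?_, fun h => ⟨z - p, (hlat _).2 h, by ring⟩⟩
    rintro ⟨γ, hγ, rfl⟩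
    simpa using (hlat _).1 hγ
  have hPn : ∀ z, z ∉ Pset ω₁ ω₃ p ↔ (z ∉ L.lattice ∧ z - p ∉ L.lattice) := by
    intro z
    rw [hP, not_or]
  have hp' : p ∉ L.lattice := fun h => hp ((hlat p).2 h)
  have hev : ∀ᶠ z in 𝓝[≠] (0 : ℂ), z ∉ Pset ω₁ ω₃ p := by
    filter_upwards [ev_notMem L 0, ev_notMem_sub L p 0] with w h1 h2 using (hPn w).2 ⟨h1, h2⟩
  have hPo : IsOpen (Pset ω₁ ω₃ p)ᶜ := by
    have : (Pset ω₁ ω₃ p)ᶜ = (L.lattice : Set ℂ)ᶜ ∩ (fun z => z - p) ⁻¹' (L.lattice : Set ℂ)ᶜ := by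
      ext z
      exact hPn z
    rw [this]
    exact L.isClosed_lattice.isOpen_compl.inter
      (L.isClosed_lattice.isOpen_compl.preimage (by fun_prop))
  refine ⟨![FF L p, fun _ => 1], ?_, ?_, ?_⟩
  · intro i
    fin_cases i
    · refine ⟨fun z hz => ?_, fun z hz γ hγ => ?_, fun q hq => ?_⟩
      · obtain ⟨h1, h2⟩ := (hPn z).1 hz
        exact (FF_diff L p z h1 h2).differentiableWithinAt
      · exact FF_per L p z ⟨γ, (hlat γ).1 hγ⟩
      · rcases (hP q).1 hq with h | h
        · exact ⟨1, FF_pole1 L p hp' q h⟩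
        · exact ⟨-1, FF_pole2 L p hp' q h⟩
    · refine ⟨differentiableOn_const _, fun z hz γ hγ => rfl, fun q hq => ⟨0, 1, ?_⟩⟩
      simp
  · intro c hc
    simp only [Fin.sum_univ_two, Matrix.cons_val_zero, Matrix.cons_val_one, mul_one] at hc
    obtain ⟨d, hd⟩ := FF_pole1 L p hp' 0 (zero_mem _)
    have hid : Tendsto (fun z : ℂ => z) (𝓝[≠] 0) (𝓝 0) := nhdsWithin_le_nhds
    have h1 := ((hid.mul hd).const_mul (c 0)).add ((hid.mul_const (c 1)).add_const (c 0))
    have h2 : Tendsto (fun _ : ℂ => (0 : ℂ)) (𝓝[≠] 0) (𝓝 (c 0)) := by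
      have e : c 0 * (0 * d) + (0 * c 1 + c 0) = c 0 := by ring
      rw [e] at h1
      refine h1.congr' ?_
      filter_upwards [hev, self_mem_nhdsWithin] with z hz hz0
      have hz0' : z ≠ 0 := hz0
      have h3 := hc z hz
      have h4 : z * (1 / (z - 0)) = 1 := by rw [sub_zero]; field_simp
      linear_combination z * h3 - c 0 * h4
    have hc0 : c 0 = 0 := tendsto_nhds_unique h2 tendsto_const_nhds
    obtain ⟨z, hz⟩ := hev.exists
    have h3 := hc z hz
    rw [hc0, zero_mul, zero_add] at h3
    funext i
    fin_cases i
    · exact hc0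
    · exact h3
  · rintro s ⟨hs1, hs2, hs3⟩
    obtain ⟨a, b, hab⟩ := two_ends_aux L p hp' s
      (fun z h1 h2 => hs1.differentiableAt (hPo.mem_nhds ((hPn z).2 ⟨h1, h2⟩)))
      (fun z h1 h2 γ hγ => hs2 z ((hPn z).2 ⟨h1, h2⟩) γ ((hlat γ).2 hγ))
      (by simpa using hs3 0 ((hP 0).2 (Or.inl (zero_mem _))))
      (hs3 p ((hP p).2 (Or.inr (by simp))))
    refine ⟨![a, b], fun z hz => ?_⟩
    obtain ⟨h1, h2⟩ := (hPn z).1 hz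
    simp [Fin.sum_univ_two, hab z h1 h2]
end

section
/- Let ω₁, ω₃ ∈ ℂ be ℝ-linearly independent, let Γ = {2mω₁ + 2nω₃ : m, n ∈ ℤ}, and let p ∈ ℂ∖Γ. Suppose there exists a holomorphic function s on ℂ∖(Γ ∪ (p + Γ)), not identically zero, such that s(z + 2ω₁) = −s(z) and s(z + 2ω₃) = −s(z) for all z in the domain, and such that at every point q ∈ Γ ∪ (p + Γ) the function s has at most a simple pole with vanishing constant Laurent term at q, i.e., there exists r ∈ ℂ with s(z) − r/(z − q) → 0 as z → q. Then p − (ω₁ + ω₃) ∈ Γ. -/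
open Complex Filter Set Topology

namespace TwoEnds

/-- The period pair with periods `2ω₁`, `2ω₃`. -/
noncomputable def pp (ω₁ ω₃ : ℂ) (h : LinearIndependent ℝ ![ω₁, ω₃]) : PeriodPair where
  ω₁ := 2 * ω₁
  ω₂ := 2 * ω₃
  indep := by
    rw [LinearIndependent.pair_iff] at h ⊢
    intro s t hst
    have := h (2 * s) (2 * t) (by
      rw [← hst]; simp only [Complex.real_smul]; push_cast; ring)
    constructor <;> linarith [this.1, this.2]

lemma mem_pp {ω₁ ω₃ : ℂ} (h : LinearIndependent ℝ ![ω₁, ω₃]) (z : ℂ) :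
    z ∈ (pp ω₁ ω₃ h).lattice ↔ z ∈ lat ω₁ ω₃ := by
  rw [PeriodPair.mem_lattice]
  simp only [lat, pp, mem_ofPred_eq]
  constructor
  · rintro ⟨m, n, e⟩; exact ⟨m, n, by rw [← e]; ring⟩
  · rintro ⟨m, n, e⟩; exact ⟨m, n, by rw [e]; ring⟩

lemma lat_zero (ω₁ ω₃ : ℂ) : (0 : ℂ) ∈ lat ω₁ ω₃ := ⟨0, 0, by simp⟩

lemma lat_add {ω₁ ω₃ a b : ℂ} (ha : a ∈ lat ω₁ ω₃) (hb : b ∈ lat ω₁ ω₃) :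
    a + b ∈ lat ω₁ ω₃ := by
  obtain ⟨m, n, rfl⟩ := ha
  obtain ⟨k, l, rfl⟩ := hb
  exact ⟨m + k, n + l, by push_cast; ring⟩

lemma lat_neg {ω₁ ω₃ a : ℂ} (ha : a ∈ lat ω₁ ω₃) : -a ∈ lat ω₁ ω₃ := by
  obtain ⟨m, n, rfl⟩ := ha
  exact ⟨-m, -n, by push_cast; ring⟩

lemma lat_sub {ω₁ ω₃ a b : ℂ} (ha : a ∈ lat ω₁ ω₃) (hb : b ∈ lat ω₁ ω₃) :
    a - b ∈ lat ω₁ ω₃ := by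
  rw [sub_eq_add_neg]; exact lat_add ha (lat_neg hb)

lemma lat_one (ω₁ ω₃ : ℂ) : 2 * ω₁ ∈ lat ω₁ ω₃ := ⟨1, 0, by simp⟩
lemma lat_three (ω₁ ω₃ : ℂ) : 2 * ω₃ ∈ lat ω₁ ω₃ := ⟨0, 1, by simp⟩

lemma lat_add_iff {ω₁ ω₃ a b : ℂ} (hb : b ∈ lat ω₁ ω₃) :
    a + b ∈ lat ω₁ ω₃ ↔ a ∈ lat ω₁ ω₃ :=
  ⟨fun h => by simpa using lat_sub h hb, fun h => lat_add h hb⟩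

lemma mem_Pset {ω₁ ω₃ p z : ℂ} :
    z ∈ Pset ω₁ ω₃ p ↔ z ∈ lat ω₁ ω₃ ∨ z - p ∈ lat ω₁ ω₃ := by
  unfold Pset
  constructor
  · rintro (h | ⟨γ, h, rfl⟩)
    · exact Or.inl h
    · right; simpa using h
  · rintro (h | h)
    · exact Or.inl h
    · exact Or.inr ⟨_, h, by simp⟩

lemma Pset_add_iff {ω₁ ω₃ p a b : ℂ} (hb : b ∈ lat ω₁ ω₃) :
    a + b ∈ Pset ω₁ ω₃ p ↔ a ∈ Pset ω₁ ω₃ p := by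
  rw [mem_Pset, mem_Pset, lat_add_iff hb, show a + b - p = a - p + b by ring, lat_add_iff hb]

lemma tendsto_add_punct (z b : ℂ) : Tendsto (fun w => w + b) (𝓝[≠] z) (𝓝[≠] (z + b)) := by
  apply tendsto_nhdsWithin_of_tendsto_nhds_of_eventually_within
  · exact ((continuous_id.add continuous_const).tendsto z).mono_left nhdsWithin_le_nhds
  · filter_upwards [self_mem_nhdsWithin] with w hw
    simpa using hw

lemma lat_disc {ω₁ ω₃ : ℂ} (h : LinearIndependent ℝ ![ω₁, ω₃]) (z : ℂ) :
    ∀ᶠ w in 𝓝[≠] z, w ∉ lat ω₁ ω₃ := by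
  have := (pp ω₁ ω₃ h).compl_lattice_sdiff_singleton_mem_nhds z
  filter_upwards [nhdsWithin_le_nhds this, self_mem_nhdsWithin] with w hw hwz hl
  exact hw ⟨(mem_pp h w).2 hl, hwz⟩

lemma Pset_disc {ω₁ ω₃ : ℂ} (h : LinearIndependent ℝ ![ω₁, ω₃]) (p z : ℂ) :
    ∀ᶠ w in 𝓝[≠] z, w ∉ Pset ω₁ ω₃ p := by
  have h2 := (tendsto_add_punct z (-p)).eventually (lat_disc h (z + -p))
  filter_upwards [lat_disc h z, h2] with w h1 h2
  rw [mem_Pset, sub_eq_add_neg]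
  tauto

lemma Pset_open {ω₁ ω₃ : ℂ} (h : LinearIndependent ℝ ![ω₁, ω₃]) {p z : ℂ}
    (hz : z ∉ Pset ω₁ ω₃ p) : ∀ᶠ w in 𝓝 z, w ∉ Pset ω₁ ω₃ p := by
  have := Pset_disc h p z
  rw [eventually_nhdsWithin_iff] at this
  filter_upwards [this] with w hw
  by_cases hwz : w = z
  · rwa [hwz]
  · exact hw hwz

lemma analytic_update {F : ℂ → ℂ} {c l : ℂ} (hd : ∀ᶠ w in 𝓝[≠] c, DifferentiableAt ℂ F w)
    (hl : Tendsto F (𝓝[≠] c) (𝓝 l)) : AnalyticAt ℂ (Function.update F c l) c := by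
  apply analyticAt_of_differentiable_on_punctured_nhds_of_continuousAt
  · filter_upwards [hd, self_mem_nhdsWithin] with w hw hwc
    apply hw.congr_of_eventuallyEq
    filter_upwards [isOpen_ne.mem_nhds hwc] with x hx
    simp [Function.update_of_ne hx]
  · rwa [continuousAt_update_same]

/-- Liouville. -/
lemma master (ω₁ ω₃ p : ℂ) (hind : LinearIndependent ℝ ![ω₁, ω₃]) (ε : ℂ) (hε : ‖ε‖ = 1)
    (F : ℂ → ℂ) (hd : ∀ z ∉ Pset ω₁ ω₃ p, DifferentiableAt ℂ F z)
    (h1 : ∀ z ∉ Pset ω₁ ω₃ p, F (z + 2 * ω₁) = ε * F z)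
    (h3 : ∀ z ∉ Pset ω₁ ω₃ p, F (z + 2 * ω₃) = ε * F z)
    (L0 : ∃ l, Tendsto F (𝓝[≠] 0) (𝓝 l)) (Lp : ∃ l, Tendsto F (𝓝[≠] p) (𝓝 l)) :
    ∃ c, c = ε * c ∧ ∀ z ∉ Pset ω₁ ω₃ p, F z = c := by
  have hε0 : ε ≠ 0 := by rintro rfl; simp at hε
  -- quasi-periodicity for all lattice vectors
  let A : AddSubgroup ℂ :=
    { carrier := {γ | γ ∈ lat ω₁ ω₃ ∧ ∃ δ : ℂ, δ ≠ 0 ∧ ∀ z ∉ Pset ω₁ ω₃ p, F (z + γ) = δ * F z}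
      zero_mem' := ⟨lat_zero _ _, 1, one_ne_zero, by simp⟩
      add_mem' := by
        rintro a b ⟨ha, δ, hδ, h⟩ ⟨hb, δ', hδ', h'⟩
        refine ⟨lat_add ha hb, δ' * δ, mul_ne_zero hδ' hδ, fun z hz => ?_⟩
        rw [← add_assoc, h' _ (by rwa [Pset_add_iff ha]), h z hz, mul_assoc]
      neg_mem' := by
        rintro a ⟨ha, δ, hδ, h⟩
        refine ⟨lat_neg ha, δ⁻¹, inv_ne_zero hδ, fun z hz => ?_⟩
        have := h (z + -a) (by rwa [Pset_add_iff (lat_neg ha)])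
        rw [neg_add_cancel_right] at this
        rw [this, inv_mul_cancel_left₀ hδ] }
  have hA1 : 2 * ω₁ ∈ A := ⟨lat_one _ _, ε, hε0, h1⟩
  have hA3 : 2 * ω₃ ∈ A := ⟨lat_three _ _, ε, hε0, h3⟩
  have hA : ∀ γ ∈ lat ω₁ ω₃, γ ∈ A := by
    rintro γ ⟨m, n, rfl⟩
    have := A.add_mem (A.zsmul_mem hA1 m) (A.zsmul_mem hA3 n)
    simp only [zsmul_eq_mul] at this
    convert! this using 1
    ring
  have trans : ∀ q, (∃ l, Tendsto F (𝓝[≠] q) (𝓝 l)) → ∀ γ ∈ lat ω₁ ω₃,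
      ∃ l, Tendsto F (𝓝[≠] (q + γ)) (𝓝 l) := by
    rintro q ⟨l, hl⟩ γ hγ
    obtain ⟨-, δ, hδ, h⟩ := hA γ hγ
    refine ⟨δ * l, ?_⟩
    have t := tendsto_add_punct (q + γ) (-γ)
    rw [add_neg_cancel_right] at t
    refine ((hl.comp t).const_mul δ).congr' ?_
    filter_upwards [Pset_disc hind p (q + γ)] with w hw
    simp only [Function.comp]
    rw [← h _ (by rwa [Pset_add_iff (lat_neg hγ)]), neg_add_cancel_right]
  have lim : ∀ z, ∃ l, Tendsto F (𝓝[≠] z) (𝓝 l) := by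
    intro z
    by_cases hz : z ∈ Pset ω₁ ω₃ p
    · rw [mem_Pset] at hz
      rcases hz with hz | hz
      · simpa using trans 0 L0 z hz
      · simpa using trans p Lp _ hz
    · exact ⟨F z, (hd z hz).continuousAt.tendsto.mono_left nhdsWithin_le_nhds⟩
  choose G hG using lim
  have hGF : ∀ z ∉ Pset ω₁ ω₃ p, G z = F z := fun z hz =>
    tendsto_nhds_unique (hG z) ((hd z hz).continuousAt.tendsto.mono_left nhdsWithin_le_nhds)
  have hGd : Differentiable ℂ G := by
    intro z
    have h := analytic_update (c := z) ((Pset_disc hind p z).mono hd) (hG z)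
    apply h.differentiableAt.congr_of_eventuallyEq
    have := Pset_disc hind p z
    rw [eventually_nhdsWithin_iff] at this
    filter_upwards [this] with w hw
    by_cases hwz : w = z
    · subst hwz; simp
    · rw [Function.update_of_ne hwz, hGF w (hw hwz)]
  have per : ∀ b ∈ lat ω₁ ω₃, (∀ z ∉ Pset ω₁ ω₃ p, F (z + b) = ε * F z) →
      ∀ z, G (z + b) = ε * G z := by
    intro b hb h z
    refine tendsto_nhds_unique ((hG (z + b)).comp (tendsto_add_punct z b))
      (((hG z).const_mul ε).congr' ?_)
    filter_upwards [Pset_disc hind p z] with w hw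
    simp [h w hw]
  have p1 := per _ (lat_one _ _) h1
  have p3 := per _ (lat_three _ _) h3
  let B : AddSubgroup ℂ :=
    { carrier := {γ | ∀ z, ‖G (z + γ)‖ = ‖G z‖}
      zero_mem' := by simp
      add_mem' := by
        intro a b ha hb z
        rw [← add_assoc, hb, ha]
      neg_mem' := by
        intro a ha z
        have := ha (z + -a)
        rw [neg_add_cancel_right] at this
        exact this.symm }
  have hB1 : 2 * ω₁ ∈ B := fun z => by rw [p1, norm_mul, hε, one_mul]
  have hB3 : 2 * ω₃ ∈ B := fun z => by rw [p3, norm_mul, hε, one_mul]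
  have hB : ∀ γ ∈ lat ω₁ ω₃, γ ∈ B := by
    rintro γ ⟨m, n, rfl⟩
    have := B.add_mem (B.zsmul_mem hB1 m) (B.zsmul_mem hB3 n)
    simp only [zsmul_eq_mul] at this
    convert! this using 1
    ring
  have bdd : Bornology.IsBounded (range G) := by
    have := (IsZLattice.isCompact_range_of_periodic (pp ω₁ ω₃ hind).lattice (fun z => ‖G z‖)
      hGd.continuous.norm (fun z w hw => hB w ((mem_pp hind w).1 hw) z)).isBounded
    obtain ⟨C, hC⟩ := this.exists_norm_le
    rw [isBounded_iff_forall_norm_le]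
    refine ⟨C, ?_⟩
    rintro _ ⟨z, rfl⟩
    simpa using hC _ ⟨z, rfl⟩
  obtain ⟨c, hc⟩ := hGd.exists_const_forall_eq_of_bounded bdd
  refine ⟨c, ?_, fun z hz => by rw [← hGF z hz, hc]⟩
  have := p1 0
  rwa [hc, hc] at this

lemma ev_ne {h : ℂ → ℂ} (hm : Meromorphic h) (h0 : ∀ᶠ z in 𝓝[≠] (0 : ℂ), h z ≠ 0) (q : ℂ) :
    ∀ᶠ z in 𝓝[≠] q, h z ≠ 0 := by
  rw [← meromorphicOrderAt_ne_top_iff_eventually_ne_zero (hm q)]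
  exact hm.exists_meromorphicOrderAt_ne_top_iff_forall.1
    ⟨0, (meromorphicOrderAt_ne_top_iff_eventually_ne_zero (hm 0)).2 h0⟩ q

lemma add_not_mem {ω₁ ω₃ a z : ℂ} (h2a : 2 * a ∈ lat ω₁ ω₃) (hz : z ∉ Pset ω₁ ω₃ a) :
    z + a ∉ lat ω₁ ω₃ := by
  intro h
  apply hz
  rw [mem_Pset]
  right
  have := lat_sub h h2a
  convert! this using 1
  ring

/-- `(℘(z) - ℘(a)) (℘(z+a) - ℘(a))` is a non-zero constant for a half period `a`. -/
lemma prodConst (α β : ℂ) (hind : LinearIndependent ℝ ![α, β]) (a : ℂ) (ha : a ∉ lat α β)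
    (h2a : 2 * a ∈ lat α β) (h : ℂ → ℂ)
    (hh : ∀ z, h z = (pp α β hind).weierstrassP z - (pp α β hind).weierstrassP a) :
    ∃ K : ℂ, K ≠ 0 ∧ ∀ z ∉ Pset α β a, h z * h (z + a) = K := by
  set L := pp α β hind with hL
  have hper : ∀ l ∈ lat α β, ∀ z, h (z + l) = h z := by
    intro l hl z
    rw [hh, hh, L.weierstrassP_add_coe z ⟨l, (mem_pp hind l).2 hl⟩]
  have hfun : h = fun z => L.weierstrassP z - L.weierstrassP a := funext hh
  have hmer : Meromorphic h := by
    rw [hfun]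
    have := L.meromorphic_weierstrassP
    fun_prop
  have han : ∀ z ∉ lat α β, AnalyticAt ℂ h z := by
    intro z hz
    rw [hfun]
    exact (L.analyticOnNhd_weierstrassP z (fun h => hz ((mem_pp hind z).1 h))).sub analyticAt_const
  have hsq : Tendsto (fun z => z ^ 2 * h z) (𝓝[≠] 0) (𝓝 1) := by
    have he : ContinuousAt (L.weierstrassPExcept 0) 0 :=
      (L.analyticAt_weierstrassPExcept 0).continuousAt
    have : Tendsto (fun z => z ^ 2 * L.weierstrassPExcept 0 z + 1 - z ^ 2 * L.weierstrassP a)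
        (𝓝[≠] 0) (𝓝 (0 ^ 2 * L.weierstrassPExcept 0 0 + 1 - 0 ^ 2 * L.weierstrassP a)) := by
      apply Tendsto.mono_left _ nhdsWithin_le_nhds
      have : ContinuousAt (fun z => z ^ 2 * L.weierstrassPExcept 0 z + 1 - z ^ 2 * L.weierstrassP a)
        0 := by fun_prop
      exact this
    norm_num at this
    refine this.congr' ?_
    filter_upwards [self_mem_nhdsWithin] with z hz
    have hz : z ≠ 0 := hz
    have := L.weierstrassPExcept_add 0 z
    simp only [ZeroMemClass.coe_zero] at this
    rw [hh, ← this]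
    field_simp
    simp
    ring
  have hne0 : ∀ᶠ z in 𝓝[≠] (0 : ℂ), h z ≠ 0 := by
    filter_upwards [hsq.eventually_ne one_ne_zero] with z hz h0
    exact hz (by rw [h0, mul_zero])
  have hd' : L.derivWeierstrassP a = 0 := by
    have h1 := L.derivWeierstrassP_add_coe (-a) ⟨2 * a, (mem_pp hind _).2 h2a⟩
    rw [L.derivWeierstrassP_neg] at h1
    simp only at h1
    rw [show -a + 2 * a = a by ring] at h1
    have h1' : 2 * L.derivWeierstrassP a = 0 := by linear_combination h1
    simpa using h1'
  obtain ⟨g, hg, hgeq⟩ : ∃ g, AnalyticAt ℂ g a ∧ ∀ᶠ z in 𝓝 a, h z = (z - a) ^ 2 • g z := by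
    rw [← natCast_le_analyticOrderAt (han a ha),
      natCast_le_analyticOrderAt_iff_iteratedDeriv_eq_zero (han a ha)]
    intro i hi
    interval_cases i
    · simp [hh]
    · rw [iteratedDeriv_one, hfun, deriv_sub_const, L.deriv_weierstrassP, hd']
  have hta : Tendsto (fun z => z + a) (𝓝[≠] 0) (𝓝 a) := by
    have := (tendsto_add_punct 0 a).mono_right nhdsWithin_le_nhds
    rwa [zero_add] at this
  have L0 : ∃ l, Tendsto (fun z => h z * h (z + a)) (𝓝[≠] 0) (𝓝 l) := by
    refine ⟨1 * g a, (hsq.mul (hg.continuousAt.tendsto.comp hta)).congr' ?_⟩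
    filter_upwards [hta.eventually hgeq] with z hz
    simp only [Function.comp]
    rw [hz]
    simp only [add_sub_cancel_right, smul_eq_mul]
    ring
  have Lp : ∃ l, Tendsto (fun z => h z * h (z + a)) (𝓝[≠] a) (𝓝 l) := by
    obtain ⟨l, hl⟩ := L0
    refine ⟨l, ?_⟩
    have t := tendsto_add_punct a (-a)
    rw [add_neg_cancel] at t
    refine (hl.comp t).congr fun z => ?_
    simp only [Function.comp]
    rw [neg_add_cancel_right, mul_comm, ← hper _ h2a (z + -a)]
    congr 2; ring
  obtain ⟨K, -, hK⟩ := master α β a hind 1 (by simp) (fun z => h z * h (z + a))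
    (by
      intro z hz
      have h1 := (han z (fun h => hz (Or.inl h))).differentiableAt
      have h2 := (han (z + a) (add_not_mem h2a hz)).differentiableAt
      exact h1.mul (h2.comp z (by fun_prop) : DifferentiableAt ℂ (fun z => h (z + a)) z))
    (by
      intro z _
      simp only [one_mul]
      rw [hper _ (lat_one _ _), add_right_comm, hper _ (lat_one _ _)])
    (by
      intro z _
      simp only [one_mul]
      rw [hper _ (lat_three _ _), add_right_comm, hper _ (lat_three _ _)])
    L0 Lp
  refine ⟨K, ?_, hK⟩
  have t := tendsto_add_punct 0 a
  have e := t.eventually (ev_ne hmer hne0 (0 + a))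
  obtain ⟨z, hz1, hz2, hz3⟩ := (hne0.and (e.and (Pset_disc hind a 0))).exists
  rw [← hK z hz3]
  exact mul_ne_zero hz1 hz2

lemma exists_f (ω₁ ω₃ : ℂ) (hind : LinearIndependent ℝ ![ω₁, ω₃]) :
    ∃ f : ℂ → ℂ, Meromorphic f ∧ (∀ z ∉ lat ω₁ ω₃, DifferentiableAt ℂ f z) ∧
      (∀ z ∉ lat ω₁ ω₃, f (z + 2 * ω₁) = - f z) ∧ (∀ z ∉ lat ω₁ ω₃, f (z + 2 * ω₃) = - f z) ∧
      (∀ z, f (-z) = - f z) ∧ Tendsto (fun z => f z - 1 / z) (𝓝[≠] 0) (𝓝 0) := by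
  have hind' : LinearIndependent ℝ ![ω₁ + ω₃, ω₁ - ω₃] := by
    rw [LinearIndependent.pair_iff] at hind ⊢
    intro s t hst
    have := hind (s + t) (s - t) (by
      rw [← hst]; simp only [Complex.real_smul]; push_cast; ring)
    constructor <;> linarith [this.1, this.2]
  have ha : 2 * ω₁ ∉ lat (ω₁ + ω₃) (ω₁ - ω₃) := by
    rintro ⟨m, n, e⟩
    rw [LinearIndependent.pair_iff] at hind
    have := hind (m + n - 1) (m - n) (by
      simp only [Complex.real_smul]; push_cast; linear_combination -e / 2)
    have h1 : m + n - 1 = 0 := by exact_mod_cast this.1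
    have h2 : m - n = 0 := by exact_mod_cast this.2
    lia
  have h2a : 2 * (2 * ω₁) ∈ lat (ω₁ + ω₃) (ω₁ - ω₃) := ⟨1, 1, by push_cast; ring⟩
  have hsub : ∀ z ∉ lat ω₁ ω₃, z ∉ Pset (ω₁ + ω₃) (ω₁ - ω₃) (2 * ω₁) := by
    intro z hz h
    rw [mem_Pset] at h
    rcases h with ⟨m, n, e⟩ | ⟨m, n, e⟩
    · exact hz ⟨m + n, m - n, by rw [e]; push_cast; ring⟩
    · exact hz ⟨m + n + 1, m - n, by push_cast; linear_combination e⟩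
  set L := pp _ _ hind' with hL
  set a := 2 * ω₁ with ha_def
  set h : ℂ → ℂ := fun z => L.weierstrassP z - L.weierstrassP a with hh
  obtain ⟨K, hK0, hK⟩ := prodConst _ _ hind' a ha h2a h (fun z => rfl)
  have hne : ∀ z ∉ lat ω₁ ω₃, h z ≠ 0 ∧ h (z + a) ≠ 0 := by
    intro z hz
    have := hK z (hsub z hz)
    constructor
    · intro h0; rw [h0, zero_mul] at this; exact hK0 this.symm
    · intro h0; rw [h0, mul_zero] at this; exact hK0 this.symm
  have nl : ∀ z ∉ lat ω₁ ω₃, z ∉ L.lattice := fun z hz hl =>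
    hsub z hz (Or.inl ((mem_pp hind' z).1 hl))
  have hder : ∀ z ∉ lat ω₁ ω₃, HasDerivAt h (L.derivWeierstrassP z) z := by
    intro z hz
    have := (L.analyticOnNhd_weierstrassP z (nl z hz)).differentiableAt.hasDerivAt
    rw [L.deriv_weierstrassP] at this
    exact this.sub_const _
  have haz : ∀ z ∉ lat ω₁ ω₃, z + a ∉ lat ω₁ ω₃ := fun z hz h =>
    hz ((lat_add_iff (lat_one _ _)).1 h)
  set f : ℂ → ℂ := fun z => -(1 / 2) * (L.derivWeierstrassP z / h z) with hf
  have f1 : ∀ z ∉ lat ω₁ ω₃, f (z + a) = - f z := by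
    intro z hz
    have d1 := hder z hz
    have d2 : HasDerivAt (fun z => h (z + a)) (L.derivWeierstrassP (z + a)) z :=
      (hder (z + a) (haz z hz)).comp_add_const z a
    have d3 := d1.mul d2
    have d4 : HasDerivAt (h * fun z => h (z + a)) 0 z := by
      apply (hasDerivAt_const z K).congr_of_eventuallyEq
      filter_upwards [Pset_open hind' (hsub z hz)] with w hw
      exact hK w hw
    have d5 := d3.unique d4
    obtain ⟨n1, n2⟩ := hne z hz
    simp only [hf]
    field_simp
    linear_combination -d5
  have fper : ∀ l ∈ lat (ω₁ + ω₃) (ω₁ - ω₃), ∀ z, f (z + l) = f z := by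
    intro l hl z
    have h1 := L.weierstrassP_add_coe z ⟨l, (mem_pp hind' l).2 hl⟩
    have h2 := L.derivWeierstrassP_add_coe z ⟨l, (mem_pp hind' l).2 hl⟩
    simp only at h1 h2
    simp only [hf, hh, h1, h2]
  refine ⟨f, ?_, ?_, f1, ?_, ?_, ?_⟩
  · have h1 := L.meromorphic_weierstrassP
    have h2 := L.meromorphic_derivWeierstrassP
    simp only [hf, hh]
    fun_prop
  · intro z hz
    have h1 := (L.analyticOnNhd_derivWeierstrassP z (nl z hz)).differentiableAt
    exact (h1.div (hder z hz).differentiableAt (hne z hz).1).const_mul _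
  · intro z hz
    rw [← f1 z hz, ← fper _ ⟨0, -1, rfl⟩ (z + a)]
    congr 1
    push_cast
    ring
  · intro z
    simp only [hf, hh, L.weierstrassP_neg, L.derivWeierstrassP_neg]
    ring
  · have he : ContinuousAt (L.weierstrassPExcept 0) 0 :=
      (L.analyticAt_weierstrassPExcept 0).continuousAt
    have he' : ContinuousAt (L.derivWeierstrassPExcept 0) 0 :=
      (L.analyticAt_derivWeierstrassPExcept 0).continuousAt
    let N : ℂ → ℂ := fun z => z ^ 2 * L.derivWeierstrassPExcept 0 z +
      2 * z * (L.weierstrassPExcept 0 z - L.weierstrassP a)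
    let M : ℂ → ℂ := fun z => 1 + z ^ 2 * (L.weierstrassPExcept 0 z - L.weierstrassP a)
    have hM : ContinuousAt M 0 := by unfold M; fun_prop
    have hN : ContinuousAt N 0 := by unfold N; fun_prop
    have hM0 : M 0 = 1 := by simp [M]
    have hN0 : N 0 = 0 := by simp [N]
    have hc : ContinuousAt (fun z => -(1 / 2) * (N z / M z)) 0 :=
      continuousAt_const.mul (hN.div hM (by rw [hM0]; exact one_ne_zero))
    have ht := hc.tendsto.mono_left (nhdsWithin_le_nhds (s := {0}ᶜ))
    simp only [hM0, hN0, zero_div, mul_zero] at ht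
    refine ht.congr' ?_
    have hMe : ∀ᶠ z in 𝓝[≠] (0 : ℂ), M z ≠ 0 :=
      nhdsWithin_le_nhds (hM.eventually_ne (by rw [hM0]; exact one_ne_zero))
    filter_upwards [self_mem_nhdsWithin, hMe] with z hz hMz
    have hz : z ≠ 0 := hz
    have e1 := L.weierstrassPExcept_add 0 z
    have e2 := L.derivWeierstrassPExcept_sub 0 z
    simp only [ZeroMemClass.coe_zero, sub_zero] at e1 e2
    have hz2 : h z = M z / z ^ 2 := by
      simp only [hh, M]
      rw [← e1]
      field_simp
      simp
      ring
    simp only [hf]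
    rw [hz2, ← e2]
    field_simp
    simp only [N, M]
    ring

lemma final (ω₁ ω₃ p : ℂ) (hind : LinearIndependent ℝ ![ω₁, ω₃]) (hp : p ∉ lat ω₁ ω₃)
    (f : ℂ → ℂ) (hmer : Meromorphic f) (hd : ∀ z ∉ lat ω₁ ω₃, DifferentiableAt ℂ f z)
    (f1 : ∀ z ∉ lat ω₁ ω₃, f (z + 2 * ω₁) = - f z)
    (f3 : ∀ z ∉ lat ω₁ ω₃, f (z + 2 * ω₃) = - f z)
    (fodd : ∀ z, f (-z) = - f z) (f0 : Tendsto (fun z => f z - 1 / z) (𝓝[≠] 0) (𝓝 0))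
    (hfp : f p = 0) : p - (ω₁ + ω₃) ∈ lat ω₁ ω₃ := by
  by_contra hcon
  set w := ω₁ + ω₃ with hw
  have h2w : 2 * w ∈ lat ω₁ ω₃ := ⟨1, 1, by push_cast; ring⟩
  have hwn : w ∉ lat ω₁ ω₃ := by
    rintro ⟨m, n, e⟩
    rw [LinearIndependent.pair_iff] at hind
    have := hind (2 * m - 1) (2 * n - 1) (by
      simp only [Complex.real_smul]; push_cast; linear_combination -e)
    have h1 : 2 * m - 1 = 0 := by exact_mod_cast this.1
    lia
  have f2w : ∀ z ∉ lat ω₁ ω₃, f (z + 2 * w) = f z := by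
    intro z hz
    rw [show z + 2 * w = z + 2 * ω₁ + 2 * ω₃ by rw [hw]; ring,
      f3 _ (by rwa [lat_add_iff (lat_one _ _)]), f1 z hz, neg_neg]
  have hfw : f w = 0 := by
    have h1 := f2w (-w) (fun h => hwn (by simpa using lat_neg h))
    rw [fodd, show -w + 2 * w = w by ring] at h1
    have : 2 * f w = 0 := by linear_combination h1
    simpa using this
  have hzf : Tendsto (fun z => z * f z) (𝓝[≠] 0) (𝓝 1) := by
    have hz : Tendsto (fun z : ℂ => z) (𝓝[≠] 0) (𝓝 0) := tendsto_id.mono_left nhdsWithin_le_nhds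
    have := (hz.mul f0).add_const 1
    norm_num at this
    refine this.congr' ?_
    filter_upwards [self_mem_nhdsWithin] with z hz
    have hz : z ≠ 0 := hz
    field_simp
    ring
  have hne0 : ∀ᶠ z in 𝓝[≠] (0 : ℂ), f z ≠ 0 := by
    filter_upwards [hzf.eventually_ne one_ne_zero] with z hz h0
    exact hz (by rw [h0, mul_zero])
  have L0 : ∃ l, Tendsto (fun z => f z * f (z + w)) (𝓝[≠] 0) (𝓝 l) := by
    have hs := (hd w hwn).hasDerivAt.tendsto_slope
    have t := tendsto_add_punct 0 w
    rw [zero_add] at t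
    refine ⟨_, (hzf.mul (hs.comp t)).congr' ?_⟩
    filter_upwards [self_mem_nhdsWithin] with z hz
    have hz : z ≠ 0 := hz
    simp only [Function.comp, slope_def_field, hfw]
    rw [add_sub_cancel_right]
    field_simp
    ring
  have Lp : ∃ l, Tendsto (fun z => f z * f (z + w)) (𝓝[≠] w) (𝓝 l) := by
    obtain ⟨l, hl⟩ := L0
    refine ⟨l, ?_⟩
    have t := tendsto_add_punct w (-w)
    rw [add_neg_cancel] at t
    refine (hl.comp t).congr' ?_
    filter_upwards [t.eventually (lat_disc hind 0)] with z hz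
    simp only [Function.comp]
    rw [neg_add_cancel_right, mul_comm, ← f2w _ hz]
    congr 2; ring
  obtain ⟨K, -, hK⟩ := master ω₁ ω₃ w hind 1 (by simp) (fun z => f z * f (z + w))
    (by
      intro z hz
      have h1 := hd z (fun h => hz (Or.inl h))
      have h2 := hd (z + w) (add_not_mem h2w hz)
      exact h1.mul (h2.comp z (by fun_prop) : DifferentiableAt ℂ (fun z => f (z + w)) z))
    (by
      intro z hz
      simp only [one_mul]
      rw [f1 z (fun h => hz (Or.inl h)), add_right_comm, f1 _ (add_not_mem h2w hz)]
      ring)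
    (by
      intro z hz
      simp only [one_mul]
      rw [f3 z (fun h => hz (Or.inl h)), add_right_comm, f3 _ (add_not_mem h2w hz)]
      ring)
    L0 Lp
  have hK0 : K = 0 := by
    rw [← hK p (by rw [mem_Pset]; tauto), hfp, zero_mul]
  have e := (tendsto_add_punct 0 w).eventually (ev_ne hmer hne0 (0 + w))
  obtain ⟨z, hz1, hz2, hz3⟩ := (hne0.and (e.and (Pset_disc hind w 0))).exists
  have := hK z hz3
  rw [hK0] at this
  exact mul_ne_zero hz1 hz2 this

end TwoEnds

/-- If there is a not identically vanishing function, holomorphic away from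
`Γ ∪ (p + Γ)`, anti-periodic in the directions `2ω₁` and `2ω₃`, with at most simple
poles with vanishing constant Laurent terms at the points of `Γ ∪ (p + Γ)`, then the
second end `p` lies at the half period `ω₂ = ω₁ + ω₃` modulo `Γ`. -/
theorem two_ends_at_half_periods
    (ω₁ ω₃ p : ℂ) (hind : LinearIndependent ℝ ![ω₁, ω₃]) (hp : p ∉ lat ω₁ ω₃)
    (s : ℂ → ℂ)
    (hhol : DifferentiableOn ℂ s (Pset ω₁ ω₃ p)ᶜ)
    (hnz : ∃ z ∉ Pset ω₁ ω₃ p, s z ≠ 0)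
    (hmon₁ : ∀ z ∉ Pset ω₁ ω₃ p, s (z + 2 * ω₁) = -s z)
    (hmon₃ : ∀ z ∉ Pset ω₁ ω₃ p, s (z + 2 * ω₃) = -s z)
    (hpole : ∀ q ∈ Pset ω₁ ω₃ p, ∃ r : ℂ,
      Tendsto (fun z => s z - r / (z - q)) (𝓝[≠] q) (𝓝 0)) :
    p - (ω₁ + ω₃) ∈ lat ω₁ ω₃ := by
  obtain ⟨f, hmer, hd, f1, f3, fodd, f0⟩ := TwoEnds.exists_f ω₁ ω₃ hind
  apply TwoEnds.final ω₁ ω₃ p hind hp f hmer hd f1 f3 fodd f0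
  by_contra hfp
  obtain ⟨r0, hr0⟩ := hpole 0 (TwoEnds.mem_Pset.2 (Or.inl (TwoEnds.lat_zero _ _)))
  obtain ⟨r1, hr1⟩ := hpole p (TwoEnds.mem_Pset.2 (Or.inr (by
    rw [sub_self]; exact TwoEnds.lat_zero _ _)))
  have npl : ∀ z ∉ Pset ω₁ ω₃ p, z ∉ lat ω₁ ω₃ ∧ z - p ∉ lat ω₁ ω₃ := by
    intro z hz
    rw [TwoEnds.mem_Pset] at hz
    tauto
  have hnp : -p ∉ lat ω₁ ω₃ := fun h => hp (by simpa using TwoEnds.lat_neg h)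
  set D : ℂ → ℂ := fun z => s z - r0 * f z - r1 * f (z - p) with hD
  have t0 : Tendsto D (𝓝[≠] 0) (𝓝 (-(r1 * f (-p)))) := by
    have c : Tendsto (fun z => f (z - p)) (𝓝[≠] 0) (𝓝 (f (-p))) := by
      have h1 : ContinuousAt f (0 - p) := by rw [zero_sub]; exact (hd _ hnp).continuousAt
      have h2 : ContinuousAt (fun z : ℂ => f (z - p)) 0 :=
        ContinuousAt.comp (f := fun z : ℂ => z - p) h1 (by fun_prop)
      have := h2.tendsto.mono_left (nhdsWithin_le_nhds (s := {0}ᶜ))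
      simpa using this
    have := (hr0.sub (f0.const_mul r0)).sub (c.const_mul r1)
    simp only [mul_zero, sub_zero, zero_sub] at this
    refine this.congr fun z => ?_
    simp only [hD]
    ring
  have tp : Tendsto D (𝓝[≠] p) (𝓝 (-(r0 * f p))) := by
    have c : Tendsto f (𝓝[≠] p) (𝓝 (f p)) :=
      (hd p hp).continuousAt.tendsto.mono_left nhdsWithin_le_nhds
    have t := TwoEnds.tendsto_add_punct p (-p)
    rw [add_neg_cancel] at t
    have := (hr1.sub ((f0.comp t).const_mul r1)).sub (c.const_mul r0)
    simp only [mul_zero, sub_zero, zero_sub] at this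
    refine this.congr fun z => ?_
    simp only [hD, Function.comp, ← sub_eq_add_neg]
    ring
  obtain ⟨c, hc, hDc⟩ := TwoEnds.master ω₁ ω₃ p hind (-1) (by simp) D
    (by
      intro z hz
      obtain ⟨h1, h2⟩ := npl z hz
      have hs : DifferentiableAt ℂ s z := hhol.differentiableAt (TwoEnds.Pset_open hind hz)
      have d2 : DifferentiableAt ℂ (fun z => f (z - p)) z :=
        (hd _ h2).comp z (f := fun z => z - p) (by fun_prop)
      exact (hs.sub ((hd z h1).const_mul r0)).sub (d2.const_mul r1))
    (by
      intro z hz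
      obtain ⟨h1, h2⟩ := npl z hz
      simp only [hD]
      rw [hmon₁ z hz, f1 z h1, add_sub_right_comm, f1 _ h2]
      ring)
    (by
      intro z hz
      obtain ⟨h1, h2⟩ := npl z hz
      simp only [hD]
      rw [hmon₃ z hz, f3 z h1, add_sub_right_comm, f3 _ h2]
      ring)
    ⟨_, t0⟩ ⟨_, tp⟩
  have hc0 : c = 0 := by
    have : 2 * c = 0 := by linear_combination hc
    simpa using this
  have lim : ∀ q l, Tendsto D (𝓝[≠] q) (𝓝 l) → l = 0 := by
    intro q l hl
    refine tendsto_nhds_unique hl (tendsto_const_nhds.congr' ?_)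
    filter_upwards [TwoEnds.Pset_disc hind p q] with z hz
    rw [hDc z hz, hc0]
  have e0 := lim _ _ t0
  have e1 := lim _ _ tp
  rw [fodd] at e0
  have hr1' : r1 = 0 := by simpa [hfp] using e0
  have hr0' : r0 = 0 := by simpa [hfp] using e1
  obtain ⟨z, hz, hsz⟩ := hnz
  have := hDc z hz
  simp only [hD, hr1', hr0', zero_mul, sub_zero, hc0] at this
  exact hsz this
end

section
/- Let ω₁, ω₃ ∈ ℂ be ℝ-linearly independent, let Γ = {2mω₁ + 2nω₃ : m, n ∈ ℤ}, and let p ∈ ℂ∖Γ. The set of holomorphic functions s on ℂ∖(Γ ∪ (p + Γ)) such that s(z + 2ω₁) = −s(z) and s(z + 2ω₃) = −s(z) for all z in the domain, and such that at every point q ∈ Γ ∪ (p + Γ) the function s has at most a simple pole at q (i.e., there exist r, c ∈ ℂ with s(z) − r/(z − q) → c as z → q), is a complex vector space of dimension 2. -/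
open Complex Filter Set Topology

/-- `s` is holomorphic away from `Γ ∪ (p + Γ)`, anti-periodic in the directions `2ω₁`
and `2ω₃`, and has at most a simple pole at every point of `Γ ∪ (p + Γ)`. -/
def CondEight (ω₁ ω₃ p : ℂ) (s : ℂ → ℂ) : Prop :=
  DifferentiableOn ℂ s (Pset ω₁ ω₃ p)ᶜ ∧
  (∀ z ∉ Pset ω₁ ω₃ p, s (z + 2 * ω₁) = -s z) ∧
  (∀ z ∉ Pset ω₁ ω₃ p, s (z + 2 * ω₃) = -s z) ∧
  ∀ q ∈ Pset ω₁ ω₃ p, ∃ r c : ℂ,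
    Tendsto (fun z => s z - r / (z - q)) (𝓝[≠] q) (𝓝 c)


def HasPole (f : ℂ → ℂ) (q r : ℂ) : Prop :=
  ∃ c : ℂ, Tendsto (fun z => f z - r / (z - q)) (𝓝[≠] q) (𝓝 c)

namespace HasPole

lemma add {f g : ℂ → ℂ} {q r s : ℂ} (hf : HasPole f q r) (hg : HasPole g q s) :
    HasPole (fun z => f z + g z) q (r + s) := by
  obtain ⟨c, hc⟩ := hf
  obtain ⟨d, hd⟩ := hg
  refine ⟨c + d, (hc.add hd).congr fun z => ?_⟩
  ring

lemma const_mul {f : ℂ → ℂ} {q r : ℂ} (k : ℂ) (hf : HasPole f q r) :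
    HasPole (fun z => k * f z) q (k * r) := by
  obtain ⟨c, hc⟩ := hf
  refine ⟨k * c, (hc.const_mul k).congr fun z => ?_⟩
  ring

lemma congr {f g : ℂ → ℂ} {q r : ℂ} (hf : HasPole f q r) (h : f =ᶠ[𝓝[≠] q] g) :
    HasPole g q r := by
  obtain ⟨c, hc⟩ := hf
  refine ⟨c, hc.congr' ?_⟩
  filter_upwards [h] with z hz
  rw [hz]

lemma of_continuousAt {f : ℂ → ℂ} {q : ℂ} (hf : ContinuousAt f q) : HasPole f q 0 := by
  refine ⟨f q, ?_⟩
  simpa using hf.tendsto.mono_left nhdsWithin_le_nhds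

lemma tendsto_mul {f : ℂ → ℂ} {q r : ℂ} (hf : HasPole f q r) :
    Tendsto (fun z => (z - q) * f z) (𝓝[≠] q) (𝓝 r) := by
  obtain ⟨c, hc⟩ := hf
  have h0 : Tendsto (fun z : ℂ => z - q) (𝓝[≠] q) (𝓝 0) := by
    have : ContinuousAt (fun z : ℂ => z - q) q := by fun_prop
    simpa using this.tendsto.mono_left nhdsWithin_le_nhds
  have := (h0.mul hc).add_const r
  rw [zero_mul, zero_add] at this
  refine this.congr' ?_
  filter_upwards [self_mem_nhdsWithin] with z hz
  have : z - q ≠ 0 := sub_ne_zero.2 hz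
  field_simp
  ring

lemma unique {f : ℂ → ℂ} {q r s : ℂ} (hf : HasPole f q r) (hg : HasPole f q s) : r = s :=
  tendsto_nhds_unique hf.tendsto_mul hg.tendsto_mul

lemma tendsto_punctured_add (q γ : ℂ) :
    Tendsto (fun z : ℂ => z + γ) (𝓝[≠] q) (𝓝[≠] (q + γ)) := by
  refine tendsto_nhdsWithin_of_tendsto_nhds_of_eventually_within _ ?_ ?_
  · have : ContinuousAt (fun z : ℂ => z + γ) q := by fun_prop
    exact this.tendsto.mono_left nhdsWithin_le_nhds
  · filter_upwards [self_mem_nhdsWithin] with z hz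
    simpa using hz

lemma comp_add {f : ℂ → ℂ} {q r : ℂ} (γ : ℂ) (hf : HasPole f (q + γ) r) :
    HasPole (fun z => f (z + γ)) q r := by
  obtain ⟨c, hc⟩ := hf
  refine ⟨c, (hc.comp (tendsto_punctured_add q γ)).congr fun z => ?_⟩
  simp

end HasPole

lemma sinh_bound (t : ℝ) (ht : 0 ≤ t) : t ^ 2 / 4 ≤ Real.sinh t := by
  have h1 := Real.quadratic_le_exp_of_nonneg ht
  have h2 : Real.exp (-t) ≤ 1 := Real.exp_le_one_iff.2 (by linarith)
  rw [Real.sinh_eq]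
  nlinarith

lemma norm_sin_bound (w : ℂ) : w.im ^ 2 / 4 ≤ ‖Complex.sin w‖ := by
  have h : |Real.sinh w.im| ≤ ‖Complex.sin w‖ := by
    have e1 : ‖Complex.exp (-w * I)‖ = Real.exp w.im := by simp [Complex.norm_exp]
    have e2 : ‖Complex.exp (w * I)‖ = Real.exp (-w.im) := by simp [Complex.norm_exp]
    have := abs_norm_sub_norm_le (Complex.exp (-w * I)) (Complex.exp (w * I))
    rw [e1, e2] at this
    rw [Complex.sin, Real.sinh_eq, abs_div]
    simp only [norm_div, norm_mul, Complex.norm_I, mul_one, Complex.norm_ofNat]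
    rw [abs_of_pos (two_pos : (0:ℝ) < 2)]
    gcongr
  rw [Real.abs_sinh] at h
  have := sinh_bound _ (abs_nonneg w.im)
  rw [sq_abs] at this
  linarith

namespace PeriodPair

variable (L : PeriodPair)

lemma ω₁_ne : L.ω₁ ≠ 0 := by
  have := L.indep.ne_zero 0
  simpa using this

lemma tau_im_ne : (L.ω₂ / L.ω₁).im ≠ 0 := by
  intro h
  have h1 : L.ω₂ / L.ω₁ = ((L.ω₂ / L.ω₁).re : ℂ) := by
    apply Complex.ext <;> simp [h]
  have h2 : L.ω₂ = ((L.ω₂ / L.ω₁).re : ℂ) * L.ω₁ := by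
    rw [← h1, div_mul_cancel₀ _ L.ω₁_ne]
  have := LinearIndependent.pair_iff.mp L.indep ((L.ω₂ / L.ω₁).re) (-1)
    (by simp only [Complex.real_smul]; push_cast; rw [← h2]; ring)
  norm_num at this

/-- terms of the series -/
noncomputable def T (n : ℤ) (z : ℂ) : ℂ :=
  (-1 : ℂ) ^ n / Complex.sin (Real.pi * (z / L.ω₁ - n * (L.ω₂ / L.ω₁)))

noncomputable def Phi (z : ℂ) : ℂ := ∑' n : ℤ, L.T n z

lemma T_add_one (n : ℤ) (z : ℂ) : L.T n (z + L.ω₁) = - L.T n z := by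
  unfold T
  have h : (Real.pi : ℂ) * ((z + L.ω₁) / L.ω₁ - n * (L.ω₂ / L.ω₁)) =
      Real.pi * (z / L.ω₁ - n * (L.ω₂ / L.ω₁)) + Real.pi := by
    have := L.ω₁_ne
    field_simp
    ring
  rw [h, Complex.sin_add_pi, div_neg]

lemma T_add_two (n : ℤ) (z : ℂ) : L.T (n + 1) (z + L.ω₂) = - L.T n z := by
  unfold T
  have h : (Real.pi : ℂ) * ((z + L.ω₂) / L.ω₁ - (n + 1 : ℤ) * (L.ω₂ / L.ω₁)) =
      Real.pi * (z / L.ω₁ - n * (L.ω₂ / L.ω₁)) := by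
    push_cast
    ring
  rw [h, zpow_add_one₀ (by norm_num)]
  ring

lemma Phi_add_one (z : ℂ) : L.Phi (z + L.ω₁) = - L.Phi z := by
  simp only [Phi, T_add_one, tsum_neg]

lemma Phi_add_two (z : ℂ) : L.Phi (z + L.ω₂) = - L.Phi z := by
  unfold Phi
  rw [← (Equiv.addRight (1 : ℤ)).tsum_eq]
  simp only [Equiv.coe_addRight, T_add_two, tsum_neg]

lemma mem_of_sin_eq_zero {n : ℤ} {z : ℂ}
    (h : Complex.sin (Real.pi * (z / L.ω₁ - n * (L.ω₂ / L.ω₁))) = 0) :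
    ∃ k : ℤ, z = k * L.ω₁ + n * L.ω₂ := by
  obtain ⟨k, hk⟩ := Complex.sin_eq_zero_iff.1 h
  refine ⟨k, ?_⟩
  have hpi : (Real.pi : ℂ) ≠ 0 := by exact_mod_cast Real.pi_ne_zero
  have := L.ω₁_ne
  have h2 : z / L.ω₁ - n * (L.ω₂ / L.ω₁) = k := by
    apply mul_left_cancel₀ hpi
    rw [hk]; ring
  field_simp at h2
  linear_combination h2

lemma T_differentiableAt {n : ℤ} {z : ℂ} (hz : ∀ k : ℤ, z ≠ k * L.ω₁ + n * L.ω₂) :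
    DifferentiableAt ℂ (L.T n) z := by
  unfold T
  refine DifferentiableAt.div (by fun_prop) (by fun_prop) ?_
  intro h
  obtain ⟨k, hk⟩ := L.mem_of_sin_eq_zero h
  exact hz k hk

lemma T_bound (M : ℝ) : ∃ C : ℝ, ∀ᶠ n : ℤ in cofinite, ∀ z : ℂ, ‖z / L.ω₁‖ ≤ M →
    ‖L.T n z‖ ≤ C * (1 / (n : ℝ) ^ 2) := by
  set t := (L.ω₂ / L.ω₁).im with ht
  have ht0 : t ≠ 0 := L.tau_im_ne
  have ht1 : 0 < |t| := abs_pos.2 ht0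
  have hev : ∀ᶠ n : ℤ in cofinite, 2 * M / |t| + 1 ≤ |(n : ℝ)| := by
    have := (tendsto_norm_cocompact_atTop (E := ℝ)).comp Int.tendsto_coe_cofinite
    exact this.eventually_ge_atTop _
  refine ⟨16 / t ^ 2, ?_⟩
  filter_upwards [hev, (Set.finite_singleton (0 : ℤ)).eventually_cofinite_notMem] with n hn hn0 z hz
  have hn0' : (n : ℝ) ≠ 0 := by exact_mod_cast hn0
  set w := (Real.pi : ℂ) * (z / L.ω₁ - n * (L.ω₂ / L.ω₁)) with hw
  have him : w.im = Real.pi * ((z / L.ω₁).im - n * t) := by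
    rw [hw, Complex.im_ofReal_mul, Complex.sub_im, ← Complex.ofReal_intCast,
      Complex.im_ofReal_mul]
  have h1 : |(z / L.ω₁).im| ≤ M := (Complex.abs_im_le_norm _).trans hz
  have h2 : 2 * M ≤ |(n : ℝ)| * |t| := by
    have : 2 * M / |t| ≤ |(n : ℝ)| := by linarith
    rwa [div_le_iff₀ ht1] at this
  have h3 : |(n : ℝ) * t| / 2 ≤ |(z / L.ω₁).im - n * t| := by
    have := abs_sub_abs_le_abs_sub ((n : ℝ) * t) ((z / L.ω₁).im)
    rw [abs_sub_comm] at this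
    rw [abs_mul] at this ⊢
    linarith
  have h4 : ((n : ℝ) * t) ^ 2 / 4 ≤ ((z / L.ω₁).im - n * t) ^ 2 := by
    have := pow_le_pow_left₀ (by positivity) h3 2
    rw [sq_abs, div_pow, sq_abs] at this
    linarith
  have h5 : ((n : ℝ) * t) ^ 2 / 4 ≤ w.im ^ 2 := by
    rw [him, mul_pow]
    have := Real.pi_gt_three
    have hp : 1 ≤ Real.pi ^ 2 := by nlinarith
    have := mul_le_mul_of_nonneg_right hp (sq_nonneg ((z / L.ω₁).im - n * t))
    linarith
  have h6 := norm_sin_bound w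
  have h7 : ((n : ℝ) * t) ^ 2 / 16 ≤ ‖Complex.sin w‖ := by linarith
  have h8 : 0 < ((n : ℝ) * t) ^ 2 / 16 := by positivity
  have : ‖L.T n z‖ = 1 / ‖Complex.sin w‖ := by
    unfold T
    rw [norm_div, norm_zpow]
    simp [hw]
  rw [this]
  calc 1 / ‖Complex.sin w‖ ≤ 1 / (((n : ℝ) * t) ^ 2 / 16) := one_div_le_one_div_of_le h8 h7
    _ = _ := by field_simp

lemma sum_differentiableOn (A : Set ℤ) (S : Set ℂ) (hS : IsOpen S)
    (hz : ∀ n ∈ A, ∀ z ∈ S, ∀ k : ℤ, z ≠ k * L.ω₁ + n * L.ω₂) :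
    DifferentiableOn ℂ (fun z => ∑' n : ℤ, A.indicator (fun n => L.T n z) n) S := by
  have hs : SummableLocallyUniformlyOn (fun (n : ℤ) z => A.indicator (fun n => L.T n z) n) S := by
    refine SummableLocallyUniformlyOn.of_locally_bounded_eventually hS fun K _ hK => ?_
    obtain ⟨M, hM⟩ := (hK.image (f := fun z => z / L.ω₁) (by fun_prop)).isBounded.exists_norm_le
    obtain ⟨C, hC⟩ := L.T_bound M
    refine ⟨_, (Real.summable_one_div_int_pow.2 one_lt_two).mul_left C, ?_⟩
    filter_upwards [hC] with n hn z hzK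
    exact (norm_indicator_le_norm_self _ _).trans (hn z (hM _ ⟨z, hzK, rfl⟩))
  refine hs.differentiableOn hS fun n z hzS => ?_
  by_cases hn : n ∈ A
  · simpa [hn] using L.T_differentiableAt (hz n hn z hzS)
  · simp [hn]

lemma T_summable (z : ℂ) : Summable (fun n => L.T n z) := by
  obtain ⟨C, hC⟩ := L.T_bound ‖z / L.ω₁‖
  refine ((Real.summable_one_div_int_pow.2 one_lt_two).mul_left C).of_norm_bounded_eventually ?_
  filter_upwards [hC] with n hn
  exact hn z le_rfl

lemma Phi_differentiableOn : DifferentiableOn ℂ L.Phi (L.lattice : Set ℂ)ᶜ := by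
  have := L.sum_differentiableOn Set.univ _ L.isClosed_lattice.isOpen_compl
    (fun n _ z hz k h => hz (mem_lattice.2 ⟨k, n, h.symm⟩))
  simp only [Set.indicator_univ] at this
  exact this

lemma Phi_pole_zero : HasPole L.Phi 0 (L.ω₁ / Real.pi) := by
  have hpi : (Real.pi : ℂ) ≠ 0 := by exact_mod_cast Real.pi_ne_zero
  have ha := L.ω₁_ne
  have h1 : HasPole (L.T 0) 0 (L.ω₁ / Real.pi) := by
    set g : ℂ → ℂ := fun z => Complex.sin (Real.pi * (z / L.ω₁)) with hg
    have hgd : Differentiable ℂ g := by fun_prop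
    have hder : deriv g 0 = Real.pi / L.ω₁ := by
      have : HasDerivAt g (Complex.cos (Real.pi * (0 / L.ω₁)) * (Real.pi * (1 / L.ω₁))) 0 :=
        (((hasDerivAt_id (0 : ℂ)).div_const L.ω₁).const_mul (Real.pi : ℂ)).csin
      rw [this.deriv]
      simp [div_eq_mul_inv]
    have hk : DifferentiableAt ℂ (dslope g 0) 0 :=
      ((Complex.differentiableOn_dslope (s := Set.univ) Filter.univ_mem).2
        hgd.differentiableOn).differentiableAt Filter.univ_mem
    have hk0 : dslope g 0 0 = Real.pi / L.ω₁ := by rw [dslope_same, hder]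
    have hk1 : dslope g 0 0 ≠ 0 := by rw [hk0]; exact div_ne_zero hpi ha
    have hinv : DifferentiableAt ℂ (fun z => (dslope g 0 z)⁻¹) 0 := hk.inv hk1
    have hsl := hasDerivAt_iff_tendsto_slope.1 hinv.hasDerivAt
    refine ⟨_, hsl.congr' ?_⟩
    filter_upwards [self_mem_nhdsWithin] with z hz
    have hz : z ≠ 0 := hz
    rw [slope_def_field, hk0, dslope_of_ne _ hz, slope_def_field]
    have : g 0 = 0 := by simp [hg]
    rw [this]
    simp only [T, sub_zero, inv_div, zpow_zero, Int.cast_zero, zero_mul]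
    change _ = 1 / g z - _
    by_cases hgz : g z = 0
    · simp [hgz]; ring
    · field_simp
  have h2 : ContinuousAt (fun z => ∑' n : ℤ, ({0}ᶜ : Set ℤ).indicator (fun n => L.T n z) n) 0 := by
    have hmem := L.compl_lattice_sdiff_singleton_mem_nhds 0
    refine ((L.sum_differentiableOn {0}ᶜ _ (L.isOpen_compl_lattice_sdiff (s := {0})) ?_).differentiableAt
      hmem).continuousAt
    intro n hn z hz k hk
    apply hz
    refine ⟨mem_lattice.2 ⟨k, n, hk.symm⟩, ?_⟩
    intro h0
    apply hn
    have h0 : z = 0 := h0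
    rw [h0] at hk
    have := LinearIndependent.pair_iff.mp L.indep k n (by simpa using hk.symm)
    simpa using this.2
  have h3 := h1.add (HasPole.of_continuousAt h2)
  rw [add_zero] at h3
  refine h3.congr (Eventually.of_forall fun z => ?_)
  have hs := L.T_summable z
  simp only [Phi]
  rw [hs.tsum_eq_add_tsum_ite 0]
  congr 1
  refine tsum_congr fun n => ?_
  by_cases hn : n = 0 <;> simp [hn]

lemma eventually_notMem (q : ℂ) : ∀ᶠ z in 𝓝[≠] q, z ∉ L.lattice := by
  filter_upwards [nhdsWithin_le_nhds (L.compl_lattice_sdiff_singleton_mem_nhds q),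
    self_mem_nhdsWithin] with z h1 h2 h3
  exact h1 ⟨h3, h2⟩

/-- Multipliers along the lattice. -/
lemma multiplier (P : Set ℂ) (s : ℂ → ℂ)
    (hP1 : ∀ z, z + L.ω₁ ∈ P ↔ z ∈ P) (hP2 : ∀ z, z + L.ω₂ ∈ P ↔ z ∈ P)
    (h1 : ∀ z ∉ P, s (z + L.ω₁) = - s z) (h2 : ∀ z ∉ P, s (z + L.ω₂) = - s z)
    {γ : ℂ} (hγ : γ ∈ L.lattice) :
    (∀ z, z + γ ∈ P ↔ z ∈ P) ∧ ∃ ε : ℂ, ε * ε = 1 ∧ ∀ z ∉ P, s (z + γ) = ε * s z := by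
  let G : AddSubgroup ℂ :=
    { carrier := {γ | (∀ z, z + γ ∈ P ↔ z ∈ P) ∧
        ∃ ε : ℂ, ε * ε = 1 ∧ ∀ z ∉ P, s (z + γ) = ε * s z}
      zero_mem' := ⟨by simp, 1, by simp⟩
      add_mem' := by
        rintro x y ⟨hx, e, he, hxe⟩ ⟨hy, d, hd, hyd⟩
        refine ⟨fun z => by rw [← add_assoc, hy, hx], e * d, ?_, fun z hz => ?_⟩
        · linear_combination d * d * he + hd
        · rw [← add_assoc, hyd _ (by rwa [hx]), hxe _ hz]; ring
      neg_mem' := by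
        rintro x ⟨hx, e, he, hxe⟩
        refine ⟨fun z => by rw [← hx, neg_add_cancel_right], e, he, fun z hz => ?_⟩
        have hz' : z + -x ∉ P := by rwa [← hx, neg_add_cancel_right]
        have := hxe _ hz'
        rw [neg_add_cancel_right] at this
        rw [this, ← mul_assoc, he, one_mul] }
  have g1 : L.ω₁ ∈ G := ⟨hP1, -1, by simp, fun z hz => by rw [h1 z hz]; ring⟩
  have g2 : L.ω₂ ∈ G := ⟨hP2, -1, by simp, fun z hz => by rw [h2 z hz]; ring⟩
  obtain ⟨m, n, rfl⟩ := mem_lattice.1 hγ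
  have : (m : ℂ) * L.ω₁ + n * L.ω₂ ∈ G := by
    have := G.add_mem (G.zsmul_mem g1 m) (G.zsmul_mem g2 n)
    simpa using this
  exact this

/-- Transport of a pole along the lattice. -/
lemma pole_transport (P : Set ℂ) (s : ℂ → ℂ) (hPd : ∀ q, ∀ᶠ z in 𝓝[≠] q, z ∉ P)
    (hP1 : ∀ z, z + L.ω₁ ∈ P ↔ z ∈ P) (hP2 : ∀ z, z + L.ω₂ ∈ P ↔ z ∈ P)
    (h1 : ∀ z ∉ P, s (z + L.ω₁) = - s z) (h2 : ∀ z ∉ P, s (z + L.ω₂) = - s z)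
    {γ : ℂ} (hγ : γ ∈ L.lattice) {q r : ℂ} (h : HasPole s q r) :
    ∃ ε : ℂ, HasPole s (q + γ) (ε * r) := by
  obtain ⟨-, ε, -, he⟩ := L.multiplier P s hP1 hP2 h1 h2 (L.lattice.neg_mem hγ)
  obtain ⟨-, e', -, he'⟩ := L.multiplier P s hP1 hP2 h1 h2 hγ
  have hq : HasPole (fun z => s (z + -γ)) (q + γ) r := HasPole.comp_add (-γ) (by simpa using h)
  refine ⟨e', (hq.const_mul e').congr ?_⟩
  have hev := (HasPole.tendsto_punctured_add (q + γ) (-γ)).eventually (hPd _)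
  filter_upwards [hev] with z hz
  rw [← he' _ hz, neg_add_cancel_right]

lemma liouville (P : Set ℂ) (s : ℂ → ℂ) (hPd : ∀ q, ∀ᶠ z in 𝓝[≠] q, z ∉ P)
    (h1 : ∀ z ∉ P, s (z + L.ω₁) = - s z) (h2 : ∀ z ∉ P, s (z + L.ω₂) = - s z)
    (hd : DifferentiableOn ℂ s Pᶜ) (hp : ∀ q ∈ P, HasPole s q 0) :
    ∀ z ∉ P, s z = 0 := by
  have hnhds : ∀ z ∉ P, Pᶜ ∈ 𝓝 z := by
    intro z hz
    have := hPd z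
    rw [eventually_nhdsWithin_iff] at this
    filter_upwards [this] with w hw
    by_cases h : w = z
    · rw [h]; exact hz
    · exact hw h
  have hda : ∀ z ∉ P, DifferentiableAt ℂ s z := fun z hz => hd.differentiableAt (hnhds z hz)
  have hall : ∀ q, ∃ c, Tendsto s (𝓝[≠] q) (𝓝 c) := by
    intro q
    by_cases hq : q ∈ P
    · obtain ⟨c, hc⟩ := hp q hq
      exact ⟨c, by simpa using hc⟩
    · exact ⟨_, (hda q hq).continuousAt.tendsto.mono_left nhdsWithin_le_nhds⟩
  choose H hH using hall
  have hHs : ∀ z ∉ P, H z = s z := fun z hz => tendsto_nhds_unique (hH z)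
    ((hda z hz).continuousAt.tendsto.mono_left nhdsWithin_le_nhds)
  have hHd : Differentiable ℂ H := by
    intro q
    refine (Complex.analyticAt_of_differentiable_on_punctured_nhds_of_continuousAt ?_
      ?_).differentiableAt
    · filter_upwards [hPd q] with z hz
      refine (hda z hz).congr_of_eventuallyEq ?_
      filter_upwards [hnhds z hz] with w hw
      exact hHs w hw
    · rw [continuousAt_iff_punctured_nhds]
      refine (hH q).congr' ?_
      filter_upwards [hPd q] with z hz
      exact (hHs z hz).symm
  have key : ∀ γ, (∀ z ∉ P, s (z + γ) = - s z) → ∀ z, H (z + γ) = - H z := by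
    intro γ hγ z
    refine tendsto_nhds_unique ((hH (z + γ)).comp (HasPole.tendsto_punctured_add z γ)) ?_
    refine (hH z).neg.congr' ?_
    filter_upwards [hPd z] with w hw
    exact (hγ w hw).symm
  have k1 := key _ h1
  have k2 := key _ h2
  have hb : Bornology.IsBounded (Set.range H) := by
    obtain ⟨C, hC⟩ := ((isCompact_closedBall (0 : ℂ) (∑ i, ‖L.basis i‖)).image
      hHd.continuous).isBounded.exists_norm_le
    refine isBounded_iff_forall_norm_le.2 ⟨C, ?_⟩
    rintro _ ⟨z, rfl⟩
    have hfl : ((ZSpan.floor L.basis z : Submodule.span ℤ (Set.range L.basis)) : ℂ) ∈ L.lattice := by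
      rw [L.lattice_eq_span_range_basis]; exact Subtype.mem _
    obtain ⟨-, e, he, hez⟩ := L.multiplier ∅ H (by simp) (by simp) (fun z _ => k1 z)
      (fun z _ => k2 z) hfl
    have hen : ‖e‖ = 1 := by
      have := congrArg norm he
      rw [norm_mul, norm_one] at this
      nlinarith [norm_nonneg e]
    have hz := hez (ZSpan.fract L.basis z) (by simp)
    rw [ZSpan.fract_apply, sub_add_cancel] at hz
    rw [hz, norm_mul, hen, one_mul]
    refine hC _ ⟨_, ?_, rfl⟩
    rw [← ZSpan.fract_apply, mem_closedBall_zero_iff]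
    exact ZSpan.norm_fract_le L.basis z
  intro z hz
  have e1 := hHd.apply_eq_apply_of_bounded hb (z + L.ω₁) z
  rw [k1] at e1
  rw [← hHs z hz]
  linear_combination (-1 / 2 : ℂ) * e1

end PeriodPair

/-- The space of functions with anti-periodic monodromy `h₀(2ω₁) = h₀(2ω₃) = −1` and
at most simple poles at the points of `Γ ∪ (p + Γ)` has complex dimension 2. -/
theorem two_ends_antiperiodic_simple_pole_space_dim_two
    (ω₁ ω₃ p : ℂ) (hind : LinearIndependent ℝ ![ω₁, ω₃]) (hp : p ∉ lat ω₁ ω₃) :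
    ∃ b : Fin 2 → ℂ → ℂ,
      (∀ i, CondEight ω₁ ω₃ p (b i)) ∧
      (∀ c : Fin 2 → ℂ, (∀ z ∉ Pset ω₁ ω₃ p, ∑ i, c i * b i z = 0) → c = 0) ∧
      (∀ s : ℂ → ℂ, CondEight ω₁ ω₃ p s →
        ∃ c : Fin 2 → ℂ, ∀ z ∉ Pset ω₁ ω₃ p, s z = ∑ i, c i * b i z) := by
  have h2ind : LinearIndependent ℝ ![2 * ω₁, 2 * ω₃] := by
    rw [LinearIndependent.pair_iff] at hind ⊢
    intro s t hst
    refine hind s t ?_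
    simp only [Complex.real_smul] at hst ⊢
    linear_combination hst / 2
  let L : PeriodPair := ⟨2 * ω₁, 2 * ω₃, h2ind⟩
  have hlat : ∀ z, z ∈ lat ω₁ ω₃ ↔ z ∈ L.lattice := by
    intro z
    rw [PeriodPair.mem_lattice]
    constructor
    · rintro ⟨m, n, rfl⟩
      exact ⟨m, n, by change (m : ℂ) * (2 * ω₁) + n * (2 * ω₃) = _; ring⟩
    · rintro ⟨m, n, rfl⟩
      exact ⟨m, n, by change (m : ℂ) * (2 * ω₁) + n * (2 * ω₃) = _; ring⟩
  have hpL : p ∉ L.lattice := fun h => hp ((hlat p).2 h)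
  set P := Pset ω₁ ω₃ p with hPdef
  have hP : ∀ z, z ∈ P ↔ z ∈ L.lattice ∨ z - p ∈ L.lattice := by
    intro z
    simp only [hPdef, Pset, Set.mem_union, Set.mem_image, hlat]
    refine or_congr Iff.rfl ⟨?_, fun h => ⟨z - p, h, by ring⟩⟩
    rintro ⟨w, hw, rfl⟩
    simpa using hw
  have hshift : ∀ γ ∈ L.lattice, ∀ z, z + γ ∈ P ↔ z ∈ P := by
    intro γ hγ z
    rw [hP, hP, add_sub_right_comm, L.lattice.add_mem_iff_left hγ, L.lattice.add_mem_iff_left hγ]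
  have hP1 : ∀ z, z + L.ω₁ ∈ P ↔ z ∈ P := hshift _ L.ω₁_mem_lattice
  have hP2 : ∀ z, z + L.ω₂ ∈ P ↔ z ∈ P := hshift _ L.ω₂_mem_lattice
  have hPd : ∀ q, ∀ᶠ z in 𝓝[≠] q, z ∉ P := by
    intro q
    have := (HasPole.tendsto_punctured_add q (-p)).eventually (L.eventually_notMem _)
    filter_upwards [this, L.eventually_notMem q] with z h1 h2 h3
    rcases (hP z).1 h3 with h | h
    · exact h2 h
    · exact h1 (by rwa [← sub_eq_add_neg])
  have hρ : L.ω₁ / (Real.pi : ℂ) ≠ 0 :=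
    div_ne_zero L.ω₁_ne (by exact_mod_cast Real.pi_ne_zero)
  set ρ := L.ω₁ / (Real.pi : ℂ) with hρdef
  have hda : ∀ z, z ∉ L.lattice → DifferentiableAt ℂ L.Phi z := fun z hz =>
    L.Phi_differentiableOn.differentiableAt (L.isClosed_lattice.isOpen_compl.mem_nhds hz)
  have hpole : ∀ q, ∃ r, HasPole L.Phi q r := by
    intro q
    by_cases hq : q ∈ L.lattice
    · obtain ⟨e, he⟩ := L.pole_transport ∅ L.Phi (by simp) (by simp) (by simp)
        (fun z _ => L.Phi_add_one z) (fun z _ => L.Phi_add_two z) hq L.Phi_pole_zero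
      rw [zero_add] at he
      exact ⟨_, he⟩
    · exact ⟨0, HasPole.of_continuousAt (hda q hq).continuousAt⟩
  let F : ℂ → ℂ := fun z => L.Phi (z + -p)
  have hF1 : ∀ z, F (z + L.ω₁) = - F z := fun z => by
    simp only [F]; rw [add_right_comm, L.Phi_add_one]
  have hF2 : ∀ z, F (z + L.ω₂) = - F z := fun z => by
    simp only [F]; rw [add_right_comm, L.Phi_add_two]
  have hFd : ∀ z, z - p ∉ L.lattice → DifferentiableAt ℂ F z := fun z hz =>
    DifferentiableAt.comp z (f := fun z => z + -p)
      (hda (z + -p) (by rwa [← sub_eq_add_neg])) (differentiableAt_id.add_const (-p))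
  have hF0 : HasPole F 0 0 := by
    refine HasPole.of_continuousAt (hFd 0 ?_).continuousAt
    rw [zero_sub]
    exact fun h => hpL (by simpa using L.lattice.neg_mem h)
  have hFp : HasPole F p ρ := HasPole.comp_add (-p) (by simpa using L.Phi_pole_zero)
  have hΦ0 : HasPole L.Phi 0 ρ := L.Phi_pole_zero
  have hΦp : HasPole L.Phi p 0 := HasPole.of_continuousAt (hda p hpL).continuousAt
  refine ⟨![L.Phi, F], ?_, ?_, ?_⟩
  · intro i
    fin_cases i
    · refine ⟨fun z hz => ?_, fun z _ => L.Phi_add_one z, fun z _ => L.Phi_add_two z,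
        fun q _ => hpole q⟩
      exact (hda z fun h => hz ((hP z).2 (Or.inl h))).differentiableWithinAt
    · refine ⟨fun z hz => ?_, fun z _ => hF1 z, fun z _ => hF2 z, fun q _ => ?_⟩
      · exact (hFd z fun h => hz ((hP z).2 (Or.inr h))).differentiableWithinAt
      · obtain ⟨r, hr⟩ := hpole (q + -p)
        exact ⟨r, HasPole.comp_add (-p) hr⟩
  · intro c hc
    simp only [Fin.sum_univ_two, Matrix.cons_val_zero, Matrix.cons_val_one] at hc
    have hz : ∀ q r, HasPole (fun z => c 0 * L.Phi z + c 1 * F z) q r → r = 0 := by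
      intro q r hr
      have h0 : HasPole (fun _ => (0 : ℂ)) q 0 := HasPole.of_continuousAt continuousAt_const
      refine (hr.congr ?_).unique h0
      filter_upwards [hPd q] with z hz
      exact hc z hz
    have e0 := hz _ _ ((hΦ0.const_mul (c 0)).add (hF0.const_mul (c 1)))
    have e1 := hz _ _ ((hΦp.const_mul (c 0)).add (hFp.const_mul (c 1)))
    simp only [mul_zero, add_zero, zero_add, mul_eq_zero, hρ, or_false] at e0 e1
    funext i
    fin_cases i
    · exact e0
    · exact e1
  · rintro s ⟨hsd, hs1, hs2, hsp⟩
    obtain ⟨r0, hr0⟩ : ∃ r, HasPole s 0 r := hsp 0 ((hP 0).2 (Or.inl L.lattice.zero_mem))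
    obtain ⟨r1, hr1⟩ : ∃ r, HasPole s p r :=
      hsp p ((hP p).2 (Or.inr (by rw [sub_self]; exact L.lattice.zero_mem)))
    refine ⟨![r0 / ρ, r1 / ρ], ?_⟩
    let h : ℂ → ℂ := fun z => s z + (-(r0 / ρ) * L.Phi z + -(r1 / ρ) * F z)
    have hh1 : ∀ z ∉ P, h (z + L.ω₁) = - h z := fun z hz => by
      have : s (z + L.ω₁) = - s z := hs1 z hz
      simp only [h, hF1, L.Phi_add_one, this]; ring
    have hh2 : ∀ z ∉ P, h (z + L.ω₂) = - h z := fun z hz => by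
      have : s (z + L.ω₂) = - s z := hs2 z hz
      simp only [h, hF2, L.Phi_add_two, this]; ring
    have hh0 : HasPole h 0 0 := by
      have := hr0.add ((hΦ0.const_mul (-(r0 / ρ))).add (hF0.const_mul (-(r1 / ρ))))
      have e : r0 + (-(r0 / ρ) * ρ + -(r1 / ρ) * 0) = 0 := by field_simp; ring
      rwa [e] at this
    have hhp : HasPole h p 0 := by
      have := hr1.add ((hΦp.const_mul (-(r0 / ρ))).add (hFp.const_mul (-(r1 / ρ))))
      have e : r1 + (-(r0 / ρ) * 0 + -(r1 / ρ) * ρ) = 0 := by field_simp; ring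
      rwa [e] at this
    have hhd : DifferentiableOn ℂ h Pᶜ := by
      intro z hz
      refine (hsd z hz).add (DifferentiableAt.differentiableWithinAt ?_)
      exact ((hda z fun h => hz ((hP z).2 (Or.inl h))).const_mul _).add
        ((hFd z fun h => hz ((hP z).2 (Or.inr h))).const_mul _)
    have hhq : ∀ q ∈ P, HasPole h q 0 := by
      intro q hq
      rcases (hP q).1 hq with hq | hq
      · obtain ⟨e, he⟩ := L.pole_transport P h hPd hP1 hP2 hh1 hh2 hq hh0
        simpa using he
      · obtain ⟨e, he⟩ := L.pole_transport P h hPd hP1 hP2 hh1 hh2 hq hhp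
        simpa using he
    intro z hz
    have := L.liouville P h hPd hh1 hh2 hhd hhq z hz
    simp only [h] at this
    simp only [Fin.sum_univ_two, Matrix.cons_val_zero, Matrix.cons_val_one]
    linear_combination this
end

section
/- Let ω₁, ω₃ ∈ ℂ be ℝ-linearly independent, let Γ̃ = {4mω₁ + 4nω₃ : m, n ∈ ℤ}, and let H = (0 + Γ̃) ∪ (2ω₁ + Γ̃) ∪ (2ω₁ + 2ω₃ + Γ̃) ∪ (2ω₃ + Γ̃) be the set of half-period points. Let ε₁, ε₃ ∈ {1, −1} with (ε₁, ε₃) ≠ (1, 1). The set of holomorphic functions s on ℂ∖H such that s(z + 4ω₁) = ε₁·s(z) and s(z + 4ω₃) = ε₃·s(z) for all z in the domain, and such that at every point q ∈ H the function s has at most a simple pole at q (i.e., there exist r, c ∈ ℂ with s(z) − r/(z − q) → c as z → q), is a complex vector space of dimension 4. -/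
open Complex Filter Set Topology

/-- The lattice `Γ̃ = {4mω₁ + 4nω₃ : m, n ∈ ℤ}`. -/
def lat4 (ω₁ ω₃ : ℂ) : Set ℂ := {z | ∃ m n : ℤ, z = 4 * (m : ℂ) * ω₁ + 4 * (n : ℂ) * ω₃}

/-- The set `H` of the four half periods of `ℂ/Γ̃` together with all their
`Γ̃`-translates. -/
def Hset (ω₁ ω₃ : ℂ) : Set ℂ :=
  lat4 ω₁ ω₃ ∪ (fun γ => 2 * ω₁ + γ) '' lat4 ω₁ ω₃ ∪
    (fun γ => 2 * ω₁ + 2 * ω₃ + γ) '' lat4 ω₁ ω₃ ∪ (fun γ => 2 * ω₃ + γ) '' lat4 ω₁ ω₃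

/-- `s` is holomorphic away from `H`, has monodromy `ε₁`, `ε₃` in the directions
`4ω₁`, `4ω₃`, and has at most a simple pole at every point of `H`. -/
def CondTen (ω₁ ω₃ ε₁ ε₃ : ℂ) (s : ℂ → ℂ) : Prop :=
  DifferentiableOn ℂ s (Hset ω₁ ω₃)ᶜ ∧
  (∀ z ∉ Hset ω₁ ω₃, s (z + 4 * ω₁) = ε₁ * s z) ∧
  (∀ z ∉ Hset ω₁ ω₃, s (z + 4 * ω₃) = ε₃ * s z) ∧
  ∀ q ∈ Hset ω₁ ω₃, ∃ r c : ℂ,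
    Tendsto (fun z => s z - r / (z - q)) (𝓝[≠] q) (𝓝 c)


namespace ZetaAux

/-- Bound for the summand of the Weierstrass zeta function. -/
lemma zeta_bound (r : ℝ) (hr : 0 < r) (s : ℂ) (hs : ‖s‖ < r) (l : ℂ) (h : 2 * r ≤ ‖l‖) :
    ‖1 / (s - l) + 1 / l + s / l ^ 2‖ ≤ 2 * r ^ 2 * ‖l‖ ^ (-3 : ℝ) := by
  have hl : 0 < ‖l‖ := by linarith
  have hl0 : l ≠ 0 := norm_pos_iff.mp hl
  have h1 : s - l ≠ 0 := by
    intro e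
    rw [sub_eq_zero] at e
    subst e
    linarith
  have e1 : 1 / (s - l) + 1 / l + s / l ^ 2 = s ^ 2 / ((s - l) * l ^ 2) := by
    field_simp
    ring
  have h2 : ‖l‖ / 2 ≤ ‖s - l‖ := by
    rw [norm_sub_rev]
    exact .trans (by linarith) (norm_sub_norm_le l s)
  have e2 : ‖l‖ ^ (-3 : ℝ) = 1 / ‖l‖ ^ 3 := by
    rw [Real.rpow_neg hl.le]
    norm_cast
    simp
  rw [e1, e2, norm_div, norm_mul, norm_pow, norm_pow]
  calc ‖s‖ ^ 2 / (‖s - l‖ * ‖l‖ ^ 2) ≤ r ^ 2 / (‖l‖ / 2 * ‖l‖ ^ 2) := by gcongr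
    _ = 2 * r ^ 2 * (1 / ‖l‖ ^ 3) := by field_simp

/-- The Weierstrass zeta function without its pole at the origin. -/
noncomputable def zetaE (L : PeriodPair) (z : ℂ) : ℂ :=
  ∑' l : L.lattice, if l.1 = 0 then 0 else (1 / (z - l) + 1 / l + z / l ^ 2)

lemma hasSum_zetaE (L : PeriodPair) :
    HasSumLocallyUniformly
      (fun (l : L.lattice) (z : ℂ) ↦ if l.1 = 0 then 0 else (1 / (z - l) + 1 / l + z / l ^ 2))
      (zetaE L) := by
  refine L.hasSumLocallyUniformly_aux (u := fun r l => 2 * r ^ 2 * ‖l‖ ^ (-3 : ℝ)) _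
    (fun _ _ ↦ (ZLattice.summable_norm_rpow _ _ (by simp; norm_num)).mul_left _) fun r hr ↦
    Filter.eventually_atTop.mpr ⟨2 * r, ?_⟩
  rintro _ h s hs l rfl
  split_ifs
  · simpa using! show 0 ≤ 2 * r ^ 2 * (‖↑l‖ ^ 3)⁻¹ by positivity
  · exact zeta_bound r hr s hs l h

lemma hasDerivAt_term (z l : ℂ) (h : z - l ≠ 0) :
    HasDerivAt (fun z : ℂ => 1 / (z - l) + 1 / l + z / l ^ 2) (-(1 / (z - l) ^ 2 - 1 / l ^ 2)) z := by
  have h1 : HasDerivAt (fun z : ℂ => z - l) 1 z := (hasDerivAt_id z).sub_const l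
  have h2 := (((hasDerivAt_const z (1 : ℂ)).div h1 h).add_const (1 / l)).add
    ((hasDerivAt_id z).div_const (l ^ 2))
  refine h2.congr_deriv ?_
  ring

lemma hasDerivAt_zetaE (L : PeriodPair) (z : ℂ) (hz : z ∈ (L.lattice \ {0} : Set ℂ)ᶜ) :
    HasDerivAt (zetaE L) (-(L.weierstrassPExcept 0 z)) z := by
  have hterm : ∀ (l : L.lattice) (x : ℂ), x ∈ (L.lattice \ {0} : Set ℂ)ᶜ →
      HasDerivAt (fun z : ℂ => if l.1 = 0 then 0 else (1 / (z - l) + 1 / l + z / l ^ 2))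
        (-(if l.1 = 0 then 0 else (1 / (x - l) ^ 2 - 1 / l ^ 2))) x := by
    intro l x hx
    split_ifs with h0
    · simpa using hasDerivAt_const x (0 : ℂ)
    · apply hasDerivAt_term
      intro e
      rw [sub_eq_zero] at e
      subst e
      exact hx ⟨l.2, h0⟩
  have hd : DifferentiableOn ℂ (zetaE L) (L.lattice \ {0} : Set ℂ)ᶜ :=
    (hasSum_zetaE L).hasSumLocallyUniformlyOn.differentiableOn
      (.of_forall fun s ↦ .fun_sum fun i hi x hx ↦
        (hterm i x hx).differentiableAt.differentiableWithinAt) L.isOpen_compl_lattice_sdiff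
  have hda := hd.differentiableAt (L.isOpen_compl_lattice_sdiff.mem_nhds hz)
  have key : Set.EqOn (deriv (zetaE L)) (fun z => -(L.weierstrassPExcept 0 z))
      (L.lattice \ {0} : Set ℂ)ᶜ := by
    refine ((hasSum_zetaE L).tendstoLocallyUniformlyOn.deriv
      (.of_forall fun s ↦ .fun_sum fun i hi x hx ↦
        (hterm i x hx).differentiableAt.differentiableWithinAt)
      L.isOpen_compl_lattice_sdiff).unique ?_
    have := (L.hasSumLocallyUniformly_weierstrassPExcept 0).tendstoLocallyUniformlyOn
      (s := (L.lattice \ {0} : Set ℂ)ᶜ)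
    have h2 := this.neg
    refine h2.congr ?_
    intro s x hx
    simp only [Function.comp_apply, Pi.neg_apply]
    rw [(HasDerivAt.fun_sum (fun i _ => hterm i x hx)).deriv]
    simp
  have := hda.hasDerivAt
  rwa [key hz] at this

/-- The Weierstrass zeta function. -/
noncomputable def zeta (L : PeriodPair) (z : ℂ) : ℂ := zetaE L z + 1 / z

lemma hasDerivAt_zeta (L : PeriodPair) (z : ℂ) (hz : z ∉ L.lattice) :
    HasDerivAt (zeta L) (-(L.weierstrassP z)) z := by
  have h0 : z ≠ 0 := by rintro rfl; exact hz (zero_mem _)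
  have h1 := hasDerivAt_zetaE L z (fun h => hz h.1)
  have h2 : HasDerivAt (fun z : ℂ => 1 / z) (-(1 / z ^ 2)) z := by
    simpa using hasDerivAt_inv h0
  have h3 := L.weierstrassPExcept_add 0 z
  simp only [Submodule.coe_zero, sub_zero] at h3
  refine (h1.add h2).congr_deriv ?_
  rw [← h3]
  simp
  ring

lemma countable_lattice (L : PeriodPair) : (L.lattice : Set ℂ).Countable :=
  countable_of_Lindelof_of_discrete (X := L.lattice)

lemma zeta_add (L : PeriodPair) (l : ℂ) (hl : l ∈ L.lattice) :
    ∃ η : ℂ, ∀ z ∉ L.lattice, zeta L (z + l) = zeta L z + η := by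
  have hconn : IsConnected ((L.lattice : Set ℂ)ᶜ) :=
    Set.Countable.isConnected_compl_of_one_lt_rank (by simp) (countable_lattice L)
  obtain ⟨x, hx⟩ := hconn.1
  refine ⟨zeta L (x + l) - zeta L x, fun z hz => ?_⟩
  have hd : ∀ z ∉ L.lattice, HasDerivAt (fun z => zeta L (z + l)) (-(L.weierstrassP z)) z := by
    intro z hz
    have h1 : z + l ∉ L.lattice := fun h => hz (by simpa using sub_mem h hl)
    have := (hasDerivAt_zeta L (z + l) h1).comp_add_const z l
    rwa [L.weierstrassP_add_coe z ⟨l, hl⟩] at this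
  have := IsOpen.eqOn_of_deriv_eq (𝕜 := ℂ) L.isClosed_lattice.isOpen_compl hconn.2
    (f := fun z => zeta L (z + l)) (g := fun z => zeta L z + (zeta L (x + l) - zeta L x))
    (fun z hz => (hd z hz).differentiableAt.differentiableWithinAt)
    (fun z hz => ((hasDerivAt_zeta L z hz).add_const _).differentiableAt.differentiableWithinAt)
    (fun z hz => by rw [(hd z hz).deriv, ((hasDerivAt_zeta L z hz).add_const _).deriv])
    hx (by simp)
  exact this hz

/-- The twisted function with a simple pole. -/
lemma exists_twisted (L : PeriodPair) (w : ℂ) (hw : w ∉ L.lattice) (h2w : 2 * w ∈ L.lattice) :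
    ∃ f : ℂ → ℂ,
      (∀ z, z ∉ L.lattice → z - w ∉ L.lattice → DifferentiableAt ℂ f z) ∧
      (∀ l ∈ L.lattice, ∀ z, z ∉ L.lattice → z - w ∉ L.lattice → f (z + l) = f z) ∧
      (∀ z, z ∉ L.lattice → z - w ∉ L.lattice → f (z + w) = - f z) ∧
      ∃ c, Tendsto (fun z => f z - 1 / z) (𝓝[≠] 0) (𝓝 c) := by
  obtain ⟨η, hη⟩ := zeta_add L (2 * w) h2w
  refine ⟨fun z => zeta L z - zeta L (z - w) - η / 2, ?_, ?_, ?_, ?_⟩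
  · intro z hz hzw
    have h1 := (hasDerivAt_zeta L z hz).differentiableAt
    have h2 := ((hasDerivAt_zeta L (z - w) hzw).comp_sub_const z w).differentiableAt
    exact (h1.sub h2).sub_const _
  · intro l hl z hz hzw
    obtain ⟨μ, hμ⟩ := zeta_add L l hl
    have h1 := hμ z hz
    have h2 := hμ (z - w) hzw
    have e : z + l - w = z - w + l := by ring
    simp only [e, h1, h2]
    ring
  · intro z hz hzw
    have h1 := hη (z - w) hzw
    have e : z - w + 2 * w = z + w := by ring
    rw [e] at h1
    simp only [h1, add_sub_cancel_right]
    ring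
  · have hnw : (0 : ℂ) - w ∉ L.lattice := by simpa using hw
    refine ⟨zetaE L 0 - zeta L (0 - w) - η / 2, ?_⟩
    have h1 := (hasDerivAt_zetaE L 0 (by simp)).continuousAt
    have h2 := ((hasDerivAt_zeta L (0 - w) hnw).comp_sub_const 0 w).continuousAt
    have h3 : ContinuousAt (fun z => zetaE L z - zeta L (z - w) - η / 2) 0 :=
      (h1.sub h2).sub continuousAt_const
    refine (h3.tendsto.mono_left nhdsWithin_le_nhds).congr fun z => ?_
    simp only [zeta]
    ring

end ZetaAux

namespace SpinAux

/-- `g` has at most a simple pole at `q` with residue `r`. -/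
def Pole (g : ℂ → ℂ) (q r : ℂ) : Prop :=
  ∃ c : ℂ, Tendsto (fun z => g z - r / (z - q)) (𝓝[≠] q) (𝓝 c)

lemma tendsto_shift (p γ : ℂ) : Tendsto (fun z => z - γ) (𝓝[≠] (p + γ)) (𝓝[≠] p) := by
  refine tendsto_nhdsWithin_of_tendsto_nhds_of_eventually_within _ ?_ ?_
  · have : ContinuousAt (fun z : ℂ => z - γ) (p + γ) := by fun_prop
    have h := this.tendsto
    simp only [add_sub_cancel_right] at h
    exact h.mono_left nhdsWithin_le_nhds
  · filter_upwards [self_mem_nhdsWithin] with z hz h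
    apply hz
    simp only [mem_singleton_iff] at h ⊢
    linear_combination h

lemma transport {g : ℂ → ℂ} {S : Set ℂ} {γ ε : ℂ} (hg : ∀ z ∉ S, g (z + γ) = ε * g z)
    {p r c : ℂ} (hS : ∀ᶠ z in 𝓝[≠] p, z ∉ S)
    (h : Tendsto (fun z => g z - r / (z - p)) (𝓝[≠] p) (𝓝 c)) :
    Tendsto (fun z => g z - ε * r / (z - (p + γ))) (𝓝[≠] (p + γ)) (𝓝 (ε * c)) := by
  have h1 := (h.comp (tendsto_shift p γ)).const_mul ε
  refine h1.congr' ?_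
  filter_upwards [(tendsto_shift p γ).eventually hS] with z hz
  have h2 := hg _ hz
  rw [sub_add_cancel] at h2
  simp only [Function.comp_apply]
  rw [h2, show z - γ - p = z - (p + γ) by ring]
  ring

lemma Pole.residue {g : ℂ → ℂ} {q r : ℂ} (h : Pole g q r) :
    Tendsto (fun z => (z - q) * g z) (𝓝[≠] q) (𝓝 r) := by
  obtain ⟨c, hc⟩ := h
  have h1 : Tendsto (fun z : ℂ => z - q) (𝓝[≠] q) (𝓝 0) := by
    have : ContinuousAt (fun z : ℂ => z - q) q := by fun_prop
    simpa using this.tendsto.mono_left nhdsWithin_le_nhds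
  have h2 := (h1.mul hc).add_const r
  simp only [zero_mul, zero_add] at h2
  refine h2.congr' ?_
  filter_upwards [self_mem_nhdsWithin] with z hz
  have : z - q ≠ 0 := sub_ne_zero.mpr hz
  field_simp
  ring

lemma Pole.of_continuousAt {g : ℂ → ℂ} {q : ℂ} (h : ContinuousAt g q) : Pole g q 0 :=
  ⟨g q, by simpa using h.tendsto.mono_left nhdsWithin_le_nhds⟩

lemma Pole.sub_sum {s : ℂ → ℂ} {b : Fin 4 → ℂ → ℂ} {q r : ℂ} {ρ c : Fin 4 → ℂ}
    (hs : Pole s q r) (hb : ∀ i, Pole (b i) q (ρ i)) :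
    Pole (fun z => s z - ∑ i, c i * b i z) q (r - ∑ i, c i * ρ i) := by
  obtain ⟨a, ha⟩ := hs
  choose d hd using hb
  refine ⟨a - ∑ i, c i * d i, ?_⟩
  have h1 := tendsto_finsetSum Finset.univ (fun i _ => (hd i).const_mul (c i))
  refine (ha.sub h1).congr fun z => ?_
  simp only [mul_sub, Finset.sum_sub_distrib, sub_div, Finset.sum_div, mul_div_assoc]
  ring

/-- quasi-periodicity propagates to the whole lattice -/
lemma quasi (L : PeriodPair) {g : ℂ → ℂ} {S : Set ℂ} {ε₁ ε₂ : ℂ}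
    (hε₁ : ε₁ = 1 ∨ ε₁ = -1) (hε₂ : ε₂ = 1 ∨ ε₂ = -1)
    (hS : ∀ γ ∈ L.lattice, ∀ z, z + γ ∈ S ↔ z ∈ S)
    (h1 : ∀ z ∉ S, g (z + L.ω₁) = ε₁ * g z) (h2 : ∀ z ∉ S, g (z + L.ω₂) = ε₂ * g z)
    (γ : ℂ) (hγ : γ ∈ L.lattice) :
    ∃ ε : ℂ, (ε = 1 ∨ ε = -1) ∧ ∀ z ∉ S, g (z + γ) = ε * g z := by
  let G : AddSubgroup ℂ :=
    { carrier := {γ | (∀ z, z + γ ∈ S ↔ z ∈ S) ∧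
        ∃ ε : ℂ, (ε = 1 ∨ ε = -1) ∧ ∀ z ∉ S, g (z + γ) = ε * g z}
      add_mem' := by
        rintro a b ⟨ha, e, he, hea⟩ ⟨hb, e', he', heb⟩
        refine ⟨fun z => by rw [← add_assoc, hb, ha], e' * e, ?_, fun z hz => ?_⟩
        · rcases he with rfl | rfl <;> rcases he' with rfl | rfl <;> simp
        · rw [← add_assoc, heb _ (by rwa [ha]), hea _ hz, mul_assoc]
      zero_mem' := ⟨by simp, 1, by simp, by simp⟩
      neg_mem' := by
        rintro a ⟨ha, e, he, hea⟩
        have hn : ∀ z, z + -a ∈ S ↔ z ∈ S := fun z => by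
          rw [← ha (z + -a), neg_add_cancel_right]
        refine ⟨hn, e, he, fun z hz => ?_⟩
        have h := hea (z + -a) (by rwa [hn])
        rw [neg_add_cancel_right] at h
        rw [h, ← mul_assoc]
        rcases he with rfl | rfl <;> simp }
  have : L.lattice ≤ G.toIntSubmodule := by
    rw [PeriodPair.lattice, Submodule.span_le]
    rintro _ (rfl | rfl)
    · exact ⟨hS _ L.ω₁_mem_lattice, ε₁, hε₁, h1⟩
    · exact ⟨hS _ L.ω₂_mem_lattice, ε₂, hε₂, h2⟩
  exact (this hγ).2

/-- Liouville for quasi-periodic functions with removable singularities. -/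
lemma liouville (L : PeriodPair) {g : ℂ → ℂ} {S : Set ℂ} {ε₁ ε₂ : ℂ}
    (hε₁ : ε₁ = 1 ∨ ε₁ = -1) (hε₂ : ε₂ = 1 ∨ ε₂ = -1) (hne : ¬(ε₁ = 1 ∧ ε₂ = 1))
    (hS : ∀ γ ∈ L.lattice, ∀ z, z + γ ∈ S ↔ z ∈ S)
    (hSc : IsClosed S) (hSd : ∀ p, ∀ᶠ z in 𝓝[≠] p, z ∉ S)
    (hd : DifferentiableOn ℂ g Sᶜ)
    (h1 : ∀ z ∉ S, g (z + L.ω₁) = ε₁ * g z) (h2 : ∀ z ∉ S, g (z + L.ω₂) = ε₂ * g z)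
    (hp : ∀ q ∈ S, Pole g q 0) : ∀ z ∉ S, g z = 0 := by
  have hda : ∀ z ∉ S, DifferentiableAt ℂ g z := fun z hz =>
    hd.differentiableAt (hSc.isOpen_compl.mem_nhds hz)
  have hlim : ∀ q, ∃ c, Tendsto g (𝓝[≠] q) (𝓝 c) := by
    intro q
    have : Pole g q 0 := by
      by_cases hq : q ∈ S
      · exact hp q hq
      · exact Pole.of_continuousAt (hda q hq).continuousAt
    simpa [Pole] using this
  choose G hG using hlim
  have hGg : ∀ z ∉ S, G z = g z := fun z hz =>
    tendsto_nhds_unique (hG z) ((hda z hz).continuousAt.tendsto.mono_left nhdsWithin_le_nhds)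
  have hGd : Differentiable ℂ G := by
    intro q
    apply AnalyticAt.differentiableAt
    apply analyticAt_of_differentiable_on_punctured_nhds_of_continuousAt
    · filter_upwards [hSd q] with z hz
      refine (hda z hz).congr_of_eventuallyEq ?_
      filter_upwards [hSc.isOpen_compl.mem_nhds hz] with y hy
      exact hGg y hy
    · rw [continuousAt_iff_punctured_nhds]
      refine (hG q).congr' ?_
      filter_upwards [hSd q] with z hz
      exact (hGg z hz).symm
  have hquasi : ∀ γ ε : ℂ, (∀ z ∉ S, g (z + γ) = ε * g z) → ∀ z, G (z + γ) = ε * G z := by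
    intro γ ε h z
    have := transport (r := 0) h (hSd z) (by simpa using hG z)
    simp only [mul_zero, zero_div, sub_zero] at this
    exact tendsto_nhds_unique (hG _) this
  have hbdd : Bornology.IsBounded (range G) := by
    have hK : IsCompact (closure (ZSpan.fundamentalDomain L.basis)) :=
      (ZSpan.fundamentalDomain_isBounded L.basis).isCompact_closure
    obtain ⟨M, hM⟩ := hK.exists_bound_of_continuousOn hGd.continuous.continuousOn
    rw [isBounded_iff_forall_norm_le]
    refine ⟨M, ?_⟩
    rintro _ ⟨z, rfl⟩
    have hfl : (ZSpan.floor L.basis z : ℂ) ∈ L.lattice := by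
      rw [L.lattice_eq_span_range_basis]
      exact (ZSpan.floor L.basis z).2
    obtain ⟨ε, hε, hq⟩ := quasi L hε₁ hε₂ hS h1 h2 _ hfl
    have h3 := hquasi _ _ hq (ZSpan.fract L.basis z)
    have h4 : ZSpan.fract L.basis z + (ZSpan.floor L.basis z : ℂ) = z := by
      rw [ZSpan.fract_apply, sub_add_cancel]
    rw [h4] at h3
    have h5 := hM _ (subset_closure (ZSpan.fract_mem_fundamentalDomain L.basis z))
    rw [h3, norm_mul]
    rcases hε with rfl | rfl <;> simpa using h5
  have hconst := hGd.apply_eq_apply_of_bounded hbdd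
  have h0 : G 0 = 0 := by
    have e1 := hquasi _ _ h1 0
    have e2 := hquasi _ _ h2 0
    rw [hconst _ 0] at e1 e2
    rcases hε₁ with rfl | rfl
    · rcases hε₂ with rfl | rfl
      · simp at hne
      · linear_combination (1 / 2) * e2
    · linear_combination (1 / 2) * e1
  intro z hz
  rw [← hGg z hz, hconst z 0, h0]

/-- The abstract four-ends statement. -/
lemma main_abstract (L : PeriodPair) (S : Set ℂ) {ε₁ ε₂ : ℂ}
    (hε₁ : ε₁ = 1 ∨ ε₁ = -1) (hε₂ : ε₂ = 1 ∨ ε₂ = -1) (hne : ¬(ε₁ = 1 ∧ ε₂ = 1))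
    (hSc : IsClosed S) (hSd : ∀ p, ∀ᶠ z in 𝓝[≠] p, z ∉ S)
    (h : Fin 4 → ℂ) (hSh : ∀ z, z ∈ S ↔ ∃ i, z - h i ∈ L.lattice)
    (hinj : ∀ i j, h j - h i ∈ L.lattice → i = j)
    (f : ℂ → ℂ) (hf : ∀ z ∉ L.lattice, DifferentiableAt ℂ f z)
    (hf1 : ∀ z ∉ L.lattice, f (z + L.ω₁) = ε₁ * f z)
    (hf2 : ∀ z ∉ L.lattice, f (z + L.ω₂) = ε₂ * f z)
    (hf0 : ∃ c, Tendsto (fun z => f z - 1 / z) (𝓝[≠] 0) (𝓝 c)) :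
    ∃ b : Fin 4 → ℂ → ℂ,
      (∀ i, DifferentiableOn ℂ (b i) Sᶜ ∧ (∀ z ∉ S, b i (z + L.ω₁) = ε₁ * b i z) ∧
        (∀ z ∉ S, b i (z + L.ω₂) = ε₂ * b i z) ∧ ∀ q ∈ S, ∃ r, Pole (b i) q r) ∧
      (∀ c : Fin 4 → ℂ, (∀ z ∉ S, ∑ i, c i * b i z = 0) → c = 0) ∧
      (∀ s : ℂ → ℂ, (DifferentiableOn ℂ s Sᶜ ∧ (∀ z ∉ S, s (z + L.ω₁) = ε₁ * s z) ∧
        (∀ z ∉ S, s (z + L.ω₂) = ε₂ * s z) ∧ ∀ q ∈ S, ∃ r, Pole s q r) →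
        ∃ c : Fin 4 → ℂ, ∀ z ∉ S, s z = ∑ i, c i * b i z) := by
  have hSL : ∀ γ ∈ L.lattice, ∀ z, z + γ ∈ S ↔ z ∈ S := by
    intro γ hγ z
    rw [hSh, hSh]
    refine exists_congr fun i => ?_
    rw [show z + γ - h i = (z - h i) + γ by ring]
    exact add_mem_cancel_right hγ
  have hnS : ∀ z ∉ S, ∀ i, z - h i ∉ L.lattice := fun z hz i hi => hz ((hSh z).2 ⟨i, hi⟩)
  have hLd : ∀ᶠ z in 𝓝[≠] (0 : ℂ), z ∉ (L.lattice : Set ℂ) := by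
    filter_upwards [self_mem_nhdsWithin,
      nhdsWithin_le_nhds (L.compl_lattice_sdiff_singleton_mem_nhds 0)] with z hz hz' hm
    exact hz' ⟨hm, hz⟩
  have hfp : ∀ q, ∃ r, Pole f q r := by
    intro q
    by_cases hq : q ∈ L.lattice
    · obtain ⟨ε, -, hε⟩ := quasi L (S := L.lattice) hε₁ hε₂
        (fun γ hγ z => add_mem_cancel_right hγ) hf1 hf2 q hq
      obtain ⟨c, hc⟩ := hf0
      have := transport (p := 0) (r := 1) (c := c) hε hLd (by simpa using hc)
      rw [zero_add] at this
      exact ⟨_, _, this⟩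
    · exact ⟨0, Pole.of_continuousAt (hf q hq).continuousAt⟩
  let b : Fin 4 → ℂ → ℂ := fun i z => f (z - h i)
  have hbp : ∀ i q r, Pole f (q - h i) r → Pole (b i) q r := by
    rintro i q r ⟨c, hc⟩
    refine ⟨c, ?_⟩
    have := hc.comp (tendsto_shift (q - h i) (h i))
    rw [sub_add_cancel] at this
    refine this.congr fun z => ?_
    simp only [Function.comp_apply, b, sub_sub_sub_cancel_right]
  have hbres : ∀ i j, Pole (b i) (h j) (if i = j then 1 else 0) := by
    intro i j
    apply hbp
    split_ifs with hij
    · subst hij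
      rw [sub_self]
      simpa [Pole] using hf0
    · exact Pole.of_continuousAt (hf _ fun hm => hij (hinj _ _ hm)).continuousAt
  have hb : ∀ i, DifferentiableOn ℂ (b i) Sᶜ ∧ (∀ z ∉ S, b i (z + L.ω₁) = ε₁ * b i z) ∧
        (∀ z ∉ S, b i (z + L.ω₂) = ε₂ * b i z) ∧ ∀ q ∈ S, ∃ r, Pole (b i) q r := by
    intro i
    refine ⟨fun z hz => ?_, fun z hz => ?_, fun z hz => ?_, fun q _ => ?_⟩
    · have h1 := hf _ (hnS z hz i)
      have h2 : DifferentiableAt ℂ (fun z => z - h i) z := by fun_prop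
      exact (DifferentiableAt.comp z h1 h2).differentiableWithinAt
    · have := hf1 _ (hnS z hz i)
      simp only [b]
      rw [← this]
      congr 1
      ring
    · have := hf2 _ (hnS z hz i)
      simp only [b]
      rw [← this]
      congr 1
      ring
    · obtain ⟨r, hr⟩ := hfp (q - h i)
      exact ⟨r, hbp _ _ _ hr⟩
  refine ⟨b, hb, ?_, ?_⟩
  · intro c hc
    funext j
    have h1 := tendsto_finsetSum Finset.univ
      (fun i _ => ((hbres i j).residue).const_mul (c i))
    have h2 : Tendsto (fun z => ∑ i, c i * ((z - h j) * b i z)) (𝓝[≠] (h j)) (𝓝 0) := by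
      refine tendsto_const_nhds.congr' ?_
      filter_upwards [hSd (h j)] with z hz
      have := hc z hz
      calc (0 : ℂ) = (z - h j) * ∑ i, c i * b i z := by rw [this, mul_zero]
        _ = _ := by
          rw [Finset.mul_sum]
          exact Finset.sum_congr rfl fun i _ => by ring
    have h3 := tendsto_nhds_unique h1 h2
    simpa using h3
  · rintro s ⟨hsd, hs1, hs2, hsp⟩
    have hhS : ∀ j, h j ∈ S := fun j => (hSh _).2 ⟨j, by simp⟩
    choose c hc using fun j => hsp (h j) (hhS j)
    refine ⟨c, fun z hz => ?_⟩
    have hg1 : ∀ z ∉ S, (fun z => s z - ∑ i, c i * b i z) (z + L.ω₁) =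
        ε₁ * (fun z => s z - ∑ i, c i * b i z) z := by
      intro z hz
      simp only [hs1 z hz, fun i => (hb i).2.1 z hz, mul_sub, Finset.mul_sum]
      congr 1
      exact Finset.sum_congr rfl fun i _ => by ring
    have hg2 : ∀ z ∉ S, (fun z => s z - ∑ i, c i * b i z) (z + L.ω₂) =
        ε₂ * (fun z => s z - ∑ i, c i * b i z) z := by
      intro z hz
      simp only [hs2 z hz, fun i => (hb i).2.2.1 z hz, mul_sub, Finset.mul_sum]
      congr 1
      exact Finset.sum_congr rfl fun i _ => by ring
    have hgd : DifferentiableOn ℂ (fun z => s z - ∑ i, c i * b i z) Sᶜ :=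
      hsd.sub (DifferentiableOn.fun_sum fun i _ => (hb i).1.const_mul (c i))
    have hgp : ∀ q ∈ S, Pole (fun z => s z - ∑ i, c i * b i z) q 0 := by
      intro q hq
      obtain ⟨j, hj⟩ := (hSh q).1 hq
      obtain ⟨ε, -, hε⟩ := quasi L (g := fun z => s z - ∑ i, c i * b i z)
        hε₁ hε₂ hSL hg1 hg2 _ hj
      obtain ⟨d, hd⟩ := Pole.sub_sum (c := c) (hc j) (fun i => hbres i j)
      have := transport (g := fun z => s z - ∑ i, c i * b i z) hε (hSd _) hd
      rw [add_sub_cancel] at this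
      refine ⟨ε * d, ?_⟩
      simpa using this
    have := liouville L hε₁ hε₂ hne hSL hSc hSd hgd hg1 hg2 hgp z hz
    exact sub_eq_zero.mp this

end SpinAux

namespace SpinAux

lemma indep_comb {ω₁ ω₃ : ℂ} (hind : LinearIndependent ℝ ![ω₁, ω₃]) (a b c d : ℝ)
    (hdet : a * d - b * c ≠ 0) :
    LinearIndependent ℝ ![(a : ℂ) * ω₁ + b * ω₃, (c : ℂ) * ω₁ + d * ω₃] := by
  rw [LinearIndependent.pair_iff] at hind ⊢
  intro s t hst
  have h1 := hind (s * a + t * c) (s * b + t * d) (by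
    simp only [Complex.real_smul] at hst ⊢
    push_cast
    linear_combination hst)
  obtain ⟨h1, h2⟩ := h1
  constructor
  · apply (mul_eq_zero.mp (_ : s * (a * d - b * c) = 0)).resolve_right hdet
    linear_combination d * h1 - c * h2
  · apply (mul_eq_zero.mp (_ : t * (a * d - b * c) = 0)).resolve_right hdet
    linear_combination a * h2 - b * h1

lemma int_eq {ω₁ ω₃ : ℂ} (hind : LinearIndependent ℝ ![ω₁, ω₃]) (a b : ℤ)
    (h : (a : ℂ) * ω₁ + b * ω₃ = 0) : a = 0 ∧ b = 0 := by
  rw [LinearIndependent.pair_iff] at hind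
  have := hind a b (by simpa using h)
  exact_mod_cast this

/-- The lattice generated by integer combinations of the two basic periods. -/
noncomputable def pp {ω₁ ω₃ : ℂ} (hind : LinearIndependent ℝ ![ω₁, ω₃]) (a b c d : ℝ)
    (hdet : a * d - b * c ≠ 0) : PeriodPair :=
  ⟨(a : ℂ) * ω₁ + b * ω₃, (c : ℂ) * ω₁ + d * ω₃, indep_comb hind a b c d hdet⟩

lemma base_of (L P : PeriodPair) (w : ℂ) (hw : w ∉ P.lattice) (h2w : 2 * w ∈ P.lattice)
    (hP : P.lattice ≤ L.lattice) (hwL : w ∈ L.lattice) {ε₁ ε₂ : ℂ}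
    (h1 : (ε₁ = 1 ∧ L.ω₁ ∈ P.lattice) ∨ (ε₁ = -1 ∧ L.ω₁ - w ∈ P.lattice))
    (h2 : (ε₂ = 1 ∧ L.ω₂ ∈ P.lattice) ∨ (ε₂ = -1 ∧ L.ω₂ - w ∈ P.lattice)) :
    ∃ f : ℂ → ℂ, (∀ z ∉ L.lattice, DifferentiableAt ℂ f z) ∧
      (∀ z ∉ L.lattice, f (z + L.ω₁) = ε₁ * f z) ∧
      (∀ z ∉ L.lattice, f (z + L.ω₂) = ε₂ * f z) ∧
      ∃ c, Tendsto (fun z => f z - 1 / z) (𝓝[≠] 0) (𝓝 c) := by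
  obtain ⟨f, hd, hl, hfw, hc⟩ := ZetaAux.exists_twisted P w hw h2w
  have hn1 : ∀ z ∉ L.lattice, z ∉ P.lattice := fun z hz h => hz (hP h)
  have hn2 : ∀ z ∉ L.lattice, z - w ∉ P.lattice := fun z hz h =>
    hz (by simpa using add_mem (hP h) hwL)
  have key : ∀ γ ε : ℂ, ((ε = 1 ∧ γ ∈ P.lattice) ∨ (ε = -1 ∧ γ - w ∈ P.lattice)) →
      ∀ z ∉ L.lattice, f (z + γ) = ε * f z := by
    rintro γ ε (⟨rfl, hγ⟩ | ⟨rfl, hγ⟩) z hz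
    · rw [hl γ hγ z (hn1 z hz) (hn2 z hz), one_mul]
    · have hz' : z + w ∉ L.lattice := fun h => hz (by simpa using sub_mem h hwL)
      have := hl _ hγ (z + w) (hn1 _ hz') (hn2 _ hz')
      rw [show z + w + (γ - w) = z + γ by ring, hfw z (hn1 z hz) (hn2 z hz)] at this
      rw [this]
      ring
  exact ⟨f, fun z hz => hd z (hn1 z hz) (hn2 z hz), key _ _ h1, key _ _ h2, hc⟩

lemma base {ω₁ ω₃ : ℂ} (hind : LinearIndependent ℝ ![ω₁, ω₃]) (L : PeriodPair)
    (hL1 : L.ω₁ = 4 * ω₁) (hL2 : L.ω₂ = 4 * ω₃)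
    {ε₁ ε₂ : ℂ} (hε₁ : ε₁ = 1 ∨ ε₁ = -1) (hε₂ : ε₂ = 1 ∨ ε₂ = -1) (hne : ¬(ε₁ = 1 ∧ ε₂ = 1)) :
    ∃ f : ℂ → ℂ, (∀ z ∉ L.lattice, DifferentiableAt ℂ f z) ∧
      (∀ z ∉ L.lattice, f (z + L.ω₁) = ε₁ * f z) ∧
      (∀ z ∉ L.lattice, f (z + L.ω₂) = ε₂ * f z) ∧
      ∃ c, Tendsto (fun z => f z - 1 / z) (𝓝[≠] 0) (𝓝 c) := by
  rcases hε₁ with rfl | rfl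
  · rcases hε₂ with rfl | rfl
    · simp at hne
    · refine base_of L (pp hind 4 0 0 8 (by norm_num)) (4 * ω₃) ?_ ?_ ?_ ?_ (Or.inl ⟨rfl, ?_⟩)
        (Or.inr ⟨rfl, ?_⟩)
      · rw [PeriodPair.mem_lattice]
        rintro ⟨m, n, e⟩
        have := int_eq hind (4 * m) (8 * n - 4) (by
          simp [pp] at e; push_cast; linear_combination e)
        omega
      · rw [PeriodPair.mem_lattice]
        exact ⟨0, 1, by simp [pp]; ring⟩
      · intro x
        rw [PeriodPair.mem_lattice, PeriodPair.mem_lattice]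
        rintro ⟨m, n, e⟩
        exact ⟨m, 2 * n, by simp [pp, hL1, hL2] at e ⊢; linear_combination e⟩
      · rw [PeriodPair.mem_lattice]
        exact ⟨0, 1, by simp [hL2]⟩
      · rw [PeriodPair.mem_lattice]
        exact ⟨1, 0, by simp [pp, hL1]⟩
      · simp [hL2]
  · rcases hε₂ with rfl | rfl
    · refine base_of L (pp hind 8 0 0 4 (by norm_num)) (4 * ω₁) ?_ ?_ ?_ ?_ (Or.inr ⟨rfl, ?_⟩)
        (Or.inl ⟨rfl, ?_⟩)
      · rw [PeriodPair.mem_lattice]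
        rintro ⟨m, n, e⟩
        have := int_eq hind (8 * m - 4) (4 * n) (by
          simp [pp] at e; push_cast; linear_combination e)
        omega
      · rw [PeriodPair.mem_lattice]
        exact ⟨1, 0, by simp [pp]; ring⟩
      · intro x
        rw [PeriodPair.mem_lattice, PeriodPair.mem_lattice]
        rintro ⟨m, n, e⟩
        exact ⟨2 * m, n, by simp [pp, hL1, hL2] at e ⊢; linear_combination e⟩
      · rw [PeriodPair.mem_lattice]
        exact ⟨1, 0, by simp [hL1]⟩
      · simp [hL1]
      · rw [PeriodPair.mem_lattice]
        exact ⟨0, 1, by simp [pp, hL2]⟩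
    · refine base_of L (pp hind 4 4 4 (-4) (by norm_num)) (4 * ω₁) ?_ ?_ ?_ ?_ (Or.inr ⟨rfl, ?_⟩)
        (Or.inr ⟨rfl, ?_⟩)
      · rw [PeriodPair.mem_lattice]
        rintro ⟨m, n, e⟩
        have := int_eq hind (4 * m + 4 * n - 4) (4 * m - 4 * n) (by
          simp [pp] at e; push_cast; linear_combination e)
        omega
      · rw [PeriodPair.mem_lattice]
        exact ⟨1, 1, by simp [pp]; ring⟩
      · intro x
        rw [PeriodPair.mem_lattice, PeriodPair.mem_lattice]
        rintro ⟨m, n, e⟩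
        exact ⟨m + n, m - n, by simp [pp, hL1, hL2] at e ⊢; linear_combination e⟩
      · rw [PeriodPair.mem_lattice]
        exact ⟨1, 0, by simp [hL1]⟩
      · simp [hL1]
      · rw [PeriodPair.mem_lattice]
        exact ⟨0, -1, by simp [pp, hL2]; ring⟩

end SpinAux

/-- For a non-trivial spin structure `(ε₁, ε₃) ≠ (1, 1)`, the space of functions with
monodromy `(ε₁, ε₃)` and at most simple poles at the half-period set `H` has complex
dimension 4. -/
theorem four_ends_nontrivial_spin_space_dim_four
    (ω₁ ω₃ : ℂ) (hind : LinearIndependent ℝ ![ω₁, ω₃])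
    (ε₁ ε₃ : ℂ) (hε₁ : ε₁ = 1 ∨ ε₁ = -1) (hε₃ : ε₃ = 1 ∨ ε₃ = -1)
    (hnontriv : ¬(ε₁ = 1 ∧ ε₃ = 1)) :
    ∃ b : Fin 4 → ℂ → ℂ,
      (∀ i, CondTen ω₁ ω₃ ε₁ ε₃ (b i)) ∧
      (∀ c : Fin 4 → ℂ, (∀ z ∉ Hset ω₁ ω₃, ∑ i, c i * b i z = 0) → c = 0) ∧
      (∀ s : ℂ → ℂ, CondTen ω₁ ω₃ ε₁ ε₃ s →
        ∃ c : Fin 4 → ℂ, ∀ z ∉ Hset ω₁ ω₃, s z = ∑ i, c i * b i z) := by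
  obtain ⟨L, hL1, hL2⟩ : ∃ L : PeriodPair, L.ω₁ = 4 * ω₁ ∧ L.ω₂ = 4 * ω₃ :=
    ⟨SpinAux.pp hind 4 0 0 4 (by norm_num), by simp [SpinAux.pp], by simp [SpinAux.pp]⟩
  obtain ⟨M, hM1, hM2⟩ : ∃ M : PeriodPair, M.ω₁ = 2 * ω₁ ∧ M.ω₂ = 2 * ω₃ :=
    ⟨SpinAux.pp hind 2 0 0 2 (by norm_num), by simp [SpinAux.pp], by simp [SpinAux.pp]⟩
  have hlat : ∀ z, z ∈ lat4 ω₁ ω₃ ↔ z ∈ L.lattice := by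
    intro z
    rw [PeriodPair.mem_lattice, hL1, hL2]
    constructor
    · rintro ⟨m, n, e⟩
      exact ⟨m, n, by rw [e]; ring⟩
    · rintro ⟨m, n, e⟩
      exact ⟨m, n, by rw [← e]; ring⟩
  have himg : ∀ a z, z ∈ (fun γ => a + γ) '' lat4 ω₁ ω₃ ↔ z - a ∈ L.lattice := by
    intro a z
    rw [← hlat]
    constructor
    · rintro ⟨γ, hγ, rfl⟩
      simpa using hγ
    · intro h
      exact ⟨_, h, by simp⟩
  let h : Fin 4 → ℂ := ![0, 2 * ω₁, 2 * ω₁ + 2 * ω₃, 2 * ω₃]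
  have hSh : ∀ z, z ∈ Hset ω₁ ω₃ ↔ ∃ i, z - h i ∈ L.lattice := by
    intro z
    simp only [Hset, mem_union, himg, hlat, Fin.exists_fin_succ, h]
    simp [or_assoc]
  have hHM : Hset ω₁ ω₃ ⊆ (M.lattice : Set ℂ) := by
    intro z hz
    obtain ⟨i, hi⟩ := (hSh z).1 hz
    rw [PeriodPair.mem_lattice, hL1, hL2] at hi
    obtain ⟨m, n, e⟩ := hi
    simp only [SetLike.mem_coe]
    rw [PeriodPair.mem_lattice, hM1, hM2]
    fin_cases i <;> simp [h] at e
    · exact ⟨2 * m, 2 * n, by push_cast; linear_combination e⟩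
    · exact ⟨2 * m + 1, 2 * n, by push_cast; linear_combination e⟩
    · exact ⟨2 * m + 1, 2 * n + 1, by push_cast; linear_combination e⟩
    · exact ⟨2 * m, 2 * n + 1, by push_cast; linear_combination e⟩
  have hSc : IsClosed (Hset ω₁ ω₃) := M.isClosed_of_subset_lattice hHM
  have hSd : ∀ p, ∀ᶠ z in 𝓝[≠] p, z ∉ Hset ω₁ ω₃ := by
    intro p
    filter_upwards [self_mem_nhdsWithin,
      nhdsWithin_le_nhds (M.compl_lattice_sdiff_singleton_mem_nhds p)] with z hz hz' hm
    exact hz' ⟨hHM hm, hz⟩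
  have hinj : ∀ i j, h j - h i ∈ L.lattice → i = j := by
    have aux : ∀ a b : ℤ, 2 * (a : ℂ) * ω₁ + 2 * b * ω₃ ∈ L.lattice → 2 ∣ a ∧ 2 ∣ b := by
      intro a b hab
      rw [PeriodPair.mem_lattice, hL1, hL2] at hab
      obtain ⟨m, n, e⟩ := hab
      have := SpinAux.int_eq hind (4 * m - 2 * a) (4 * n - 2 * b) (by
        push_cast; linear_combination e)
      omega
    let u : Fin 4 → ℤ := ![0, 1, 1, 0]
    let v : Fin 4 → ℤ := ![0, 0, 1, 1]
    have hu : ∀ i, h i = 2 * (u i : ℂ) * ω₁ + 2 * (v i : ℂ) * ω₃ := by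
      intro i
      fin_cases i <;> simp [h, u, v]
    intro i j hij
    have h1 := aux (u j - u i) (v j - v i) (by
      convert hij using 1
      rw [hu i, hu j]
      push_cast
      ring)
    revert h1
    revert i j
    simp only [u, v]
    intro i j _
    fin_cases i <;> fin_cases j <;> simp
  obtain ⟨f, hf, hf1, hf2, hf0⟩ := SpinAux.base hind L hL1 hL2 hε₁ hε₃ hnontriv
  have key := SpinAux.main_abstract L (Hset ω₁ ω₃) hε₁ hε₃ hnontriv hSc hSd h hSh hinj f hf hf1 hf2
    hf0
  rw [hL1, hL2] at key
  exact key
end
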